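/- There exist universal constants C, c > 0 such that the following is true (main theorem, Case iv). Let (n, k, ε, r, p) ∈ ℕ × ℕ × (0,1/2) × (1/4,1/2] × [1,3/2) with n ≥ 3 and p = 2 − 2r, and let G be an n×k random matrix with i.i.d. standard normal entries. Define E = c·n·[1 + (1−2r)·ln n]·ε²/ln n and F = c·n·ε^{2/p}/(ln n)^{(2−p)/p}. If k ≤ min{E, F}, then with probability at least 1 − C·exp(−min{E, F}), for all x ∈ ℝ^k: (1−ε)·M_{r,p}·|x| ≤ |Gx|_{r,p} ≤ (1+ε)·M_{r,p}·|x|, where M_{r,p} = 𝕄 |Ge₁|_{r,p}. -/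

import Mathlib

open MeasureTheory ProbabilityTheory

/-- `decRe x` is the non-increasing rearrangement of `(|x_1|, …, |x_n|)`
(indexed from `0`, so `decRe x i = x_[i+1]` in the paper's notation). -/
noncomputable def decRe {n : ℕ} (x : Fin n → ℝ) : Fin n → ℝ :=
  fun i => |x (Tuple.sort (fun j => |x j|) i.rev)|

/-- The finite-dimensional Lorentz norm `|x|_{r,p} = (∑_{i=1}^n i^{-r} x_[i]^p)^{1/p}`. -/
noncomputable def lorNorm {n : ℕ} (r p : ℝ) (x : Fin n → ℝ) : ℝ :=
  (∑ i : Fin n, ((i : ℝ) + 1) ^ (-r) * decRe x i ^ p) ^ (1 / p)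

/-- The standard Gaussian measure `N(0, I_n)` on `ℝ^n`. -/
noncomputable def stdGaussian (n : ℕ) : Measure (Fin n → ℝ) :=
  Measure.pi fun _ => gaussianReal 0 1

/-- The law of an `n × k` random matrix with i.i.d. standard normal entries. -/
noncomputable def gaussMatrix (n k : ℕ) : Measure (Fin n → Fin k → ℝ) :=
  Measure.pi fun _ => Measure.pi fun _ => gaussianReal 0 1

/-- `mulVec g x = Gx`, the matrix-vector product. -/
noncomputable def mulVec {n k : ℕ} (g : Fin n → Fin k → ℝ) (x : Fin k → ℝ) : Fin n → ℝ :=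
  fun i => ∑ j : Fin k, g i j * x j

/-- The Euclidean norm on `Fin k → ℝ`. -/
noncomputable def eucNorm {k : ℕ} (x : Fin k → ℝ) : ℝ :=
  Real.sqrt (∑ j : Fin k, x j ^ 2)

/-- `m` is a median of `f` under `μ`. -/
def IsMedian {α : Type*} [MeasurableSpace α] (μ : Measure α) (f : α → ℝ) (m : ℝ) : Prop :=
  (1 : ENNReal) / 2 ≤ μ {x | m ≤ f x} ∧ (1 : ENNReal) / 2 ≤ μ {x | f x ≤ m}

open scoped ENNReal

lemma inner_toLp_toLp {k : ℕ} (u v : Fin k → ℝ) :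
    inner ℝ (WithLp.toLp 2 u : EuclideanSpace ℝ (Fin k)) (WithLp.toLp 2 v) = ∑ j, v j * u j := by
  rw [PiLp.inner_apply]; simp

lemma map_stdGaussian_inner {k : ℕ} {Z : EuclideanSpace ℝ (Fin k)} (hZ : inner ℝ Z Z = (1 : ℝ)) :
    (ProbabilityTheory.stdGaussian (EuclideanSpace ℝ (Fin k))).map (fun x => inner ℝ Z x) =
      gaussianReal 0 1 := by
  have h1 : HasGaussianLaw (fun x : EuclideanSpace ℝ (Fin k) => inner ℝ Z x)
      (ProbabilityTheory.stdGaussian (EuclideanSpace ℝ (Fin k))) := by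
    have h : HasGaussianLaw (id : EuclideanSpace ℝ (Fin k) → _)
      (ProbabilityTheory.stdGaussian (EuclideanSpace ℝ (Fin k))) := IsGaussian.hasGaussianLaw_id
    exact h.map (innerSL ℝ Z)
  have h2 : ∫ x, inner ℝ Z x ∂(ProbabilityTheory.stdGaussian (EuclideanSpace ℝ (Fin k))) = 0 :=
    integral_strongDual_stdGaussian (innerSL ℝ Z)
  rw [h1.map_eq_gaussianReal, h2, ← covarianceBilin_self IsGaussian.memLp_two_id,
    covarianceBilin_stdGaussian, innerSL_apply_apply, hZ]
  simp

lemma map_pi_gaussianReal_linear {k : ℕ} {u : Fin k → ℝ} (hu : ∑ j, u j ^ 2 = 1) :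
    (Measure.pi fun _ : Fin k => gaussianReal 0 1).map (fun w => ∑ j, w j * u j) =
      gaussianReal 0 1 := by
  have h := map_stdGaussian_inner (Z := WithLp.toLp 2 u) (by
    rw [inner_toLp_toLp, ← hu]; simp [pow_two])
  rw [← map_pi_eq_stdGaussian, Measure.map_map (by fun_prop) (by fun_prop)] at h
  refine Eq.trans ?_ h
  congr 1

lemma map_pi_gaussianReal_linear_pair {k : ℕ} {u v : Fin k → ℝ} (hu : ∑ j, u j ^ 2 = 1)
    (hv : ∑ j, v j ^ 2 = 1) (huv : ∑ j, u j * v j = 0) :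
    (Measure.pi fun _ : Fin k => gaussianReal 0 1).map
      (fun w => (∑ j, w j * u j, ∑ j, w j * v j)) =
      (gaussianReal 0 1).prod (gaussianReal 0 1) := by
  let E := EuclideanSpace ℝ (Fin k)
  let μ : Measure E := ProbabilityTheory.stdGaussian E
  let U : E := WithLp.toLp 2 u
  let V : E := WithLp.toLp 2 v
  have hU : inner ℝ U U = (1 : ℝ) := by
    rw [inner_toLp_toLp, ← hu]; simp [pow_two]
  have hV : inner ℝ V V = (1 : ℝ) := by
    rw [inner_toLp_toLp, ← hv]; simp [pow_two]
  have hUV : inner ℝ U V = (0 : ℝ) := by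
    rw [inner_toLp_toLp, ← huv]; simp [mul_comm]
  have hlaw : HasGaussianLaw (fun x : E => (inner ℝ U x, inner ℝ V x)) μ := by
    have h : HasGaussianLaw (id : E → E) μ := IsGaussian.hasGaussianLaw_id
    exact h.map ((innerSL ℝ U).prod (innerSL ℝ V))
  have hcov : cov[fun x : E => inner ℝ U x, fun x : E => inner ℝ V x; μ] = 0 := by
    rw [← covarianceBilin_apply_eq_cov IsGaussian.memLp_two_id, covarianceBilin_stdGaussian]
    exact hUV
  have hind := hlaw.indepFun_of_covariance_eq_zero hcov
  have hmap : μ = (Measure.pi fun _ : Fin k => gaussianReal 0 1).map (WithLp.toLp 2) :=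
    map_pi_eq_stdGaussian.symm
  rw [indepFun_iff_map_prod_eq_prod_map_map (by fun_prop) (by fun_prop),
    map_stdGaussian_inner hU, map_stdGaussian_inner hV,
    hmap, Measure.map_map (by fun_prop) (by fun_prop)] at hind
  refine Eq.trans ?_ hind
  congr 1

instance isProbabilityMeasure_stdGaussian_pi (n : ℕ) :
    IsProbabilityMeasure (_root_.stdGaussian n) := by
  unfold _root_.stdGaussian; infer_instance

instance isProbabilityMeasure_gaussMatrix (n k : ℕ) : IsProbabilityMeasure (gaussMatrix n k) := by
  unfold gaussMatrix; infer_instance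

@[fun_prop]
lemma continuous_mulVec_left {n k : ℕ} (x : Fin k → ℝ) :
    Continuous fun g : Fin n → Fin k → ℝ => mulVec g x := by
  unfold mulVec; fun_prop

@[fun_prop]
lemma measurable_mulVec_left {n k : ℕ} (x : Fin k → ℝ) :
    Measurable fun g : Fin n → Fin k → ℝ => mulVec g x :=
  (continuous_mulVec_left x).measurable

lemma map_gaussMatrix_mulVec_pair {n k : ℕ} {u v : Fin k → ℝ} (hu : ∑ j, u j ^ 2 = 1)
    (hv : ∑ j, v j ^ 2 = 1) (huv : ∑ j, u j * v j = 0) :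
    (gaussMatrix n k).map (fun g => (mulVec g u, mulVec g v)) =
      (stdGaussian n).prod (stdGaussian n) := by
  have h1 := Measure.pi_map_pi (ι := Fin n)
    (μ := fun _ => Measure.pi fun _ : Fin k => gaussianReal 0 1)
    (f := fun _ (w : Fin k → ℝ) => (∑ j, w j * u j, ∑ j, w j * v j))
    (fun _ => by fun_prop)
  simp only [map_pi_gaussianReal_linear_pair hu hv huv] at h1
  have h2 := (measurePreserving_arrowProdEquivProdArrow ℝ ℝ (Fin n)
    (fun _ => gaussianReal 0 1) (fun _ => gaussianReal 0 1)).map_eq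
  rw [← h1, Measure.map_map (MeasurableEquiv.measurable _) (by fun_prop)] at h2
  exact h2

lemma map_gaussMatrix_mulVec {n k : ℕ} {u : Fin k → ℝ} (hu : ∑ j, u j ^ 2 = 1) :
    (gaussMatrix n k).map (fun g => mulVec g u) = stdGaussian n := by
  have h1 := Measure.pi_map_pi (ι := Fin n)
    (μ := fun _ => Measure.pi fun _ : Fin k => gaussianReal 0 1)
    (f := fun _ (w : Fin k → ℝ) => ∑ j, w j * u j)
    (fun _ => (by fun_prop : Measurable fun w : Fin k → ℝ => ∑ j, w j * u j).aemeasurable)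
  simp only [map_pi_gaussianReal_linear hu] at h1
  exact h1

lemma lintegral_stdGaussian_prod {n : ℕ} {φ : Fin n → ℝ → ℝ} (h0 : ∀ i x, 0 ≤ φ i x)
    (hφ : ∀ i, Integrable (φ i) (gaussianReal 0 1)) :
    ∫⁻ x, ENNReal.ofReal (∏ i, φ i (x i)) ∂(_root_.stdGaussian n) =
      ENNReal.ofReal (∏ i, ∫ t, φ i t ∂(gaussianReal 0 1)) := by
  unfold _root_.stdGaussian
  rw [← ofReal_integral_eq_lintegral_ofReal, integral_fintype_prod_eq_prod]
  · exact Integrable.fintype_prod hφ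
  · exact Filter.Eventually.of_forall fun x => Finset.prod_nonneg fun i _ => h0 i _

lemma lintegral_exp_linear_stdGaussian {n : ℕ} (v : Fin n → ℝ) :
    ∫⁻ y, ENNReal.ofReal (Real.exp (∑ i, v i * y i)) ∂(_root_.stdGaussian n) =
      ENNReal.ofReal (Real.exp ((∑ i, v i ^ 2) / 2)) := by
  simp_rw [Real.exp_sum]
  rw [lintegral_stdGaussian_prod (φ := fun i t => Real.exp (v i * t))
    (fun i x => (Real.exp_pos _).le) (fun i => integrable_exp_mul_gaussianReal _)]
  have h (i : Fin n) : ∫ t, Real.exp (v i * t) ∂(gaussianReal 0 1) = Real.exp (v i ^ 2 / 2) := by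
    have := congrFun (mgf_fun_id_gaussianReal (μ := 0) (v := 1)) (v i)
    simpa [mgf] using this
  simp_rw [h]
  rw [← Real.exp_sum, Finset.sum_div]

lemma pow_two_mul_le_exp_add_exp_neg (m : ℕ) (z : ℝ) :
    z ^ (2 * m) ≤ (2 * m : ℝ) ^ (2 * m) * (Real.exp z + Real.exp (-z)) := by
  have h1 : z ^ (2 * m) = |z| ^ (2 * m) := by rw [pow_mul, pow_mul, sq_abs]
  have h2 := Real.pow_div_factorial_le_exp |z| (abs_nonneg z) (2 * m)
  rw [div_le_iff₀ (by positivity)] at h2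
  have h3 : ((2 * m).factorial : ℝ) ≤ (2 * m : ℝ) ^ (2 * m) := by
    exact_mod_cast Nat.factorial_le_pow (2 * m)
  have h4 : Real.exp |z| ≤ Real.exp z + Real.exp (-z) := by
    rcases abs_cases z with ⟨h, _⟩ | ⟨h, _⟩ <;> rw [h] <;> linarith [Real.exp_pos z, Real.exp_pos (-z)]
  rw [h1]
  calc |z| ^ (2 * m) ≤ Real.exp |z| * (2 * m).factorial := h2
    _ ≤ (Real.exp z + Real.exp (-z)) * (2 * m : ℝ) ^ (2 * m) := by gcongr
    _ = _ := mul_comm _ _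

lemma lintegral_linear_pow_stdGaussian_le {n : ℕ} (v : Fin n → ℝ) {m : ℕ} (hm : 1 ≤ m) :
    ∫⁻ y, ENNReal.ofReal ((∑ i, v i * y i) ^ (2 * m)) ∂(_root_.stdGaussian n) ≤
      ENNReal.ofReal ((12 * m * ∑ i, v i ^ 2) ^ m) := by
  have hm0 : (0 : ℝ) < m := by exact_mod_cast hm
  set A := ∑ i, v i ^ 2 with hA
  have hA0 : 0 ≤ A := Finset.sum_nonneg fun i _ => sq_nonneg _
  rcases hA0.eq_or_lt with h0 | hpos
  · have hv : ∀ i, v i = 0 := fun i => by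
      have := (Finset.sum_eq_zero_iff_of_nonneg (fun i _ => sq_nonneg (v i))).1 h0.symm i
        (Finset.mem_univ i)
      simpa using this
    simp [hv, show 2 * m ≠ 0 by omega]
  set s := Real.sqrt (2 * m / A) with hs
  have hs2 : s ^ 2 = 2 * m / A := Real.sq_sqrt (by positivity)
  have hs0 : 0 < s := Real.sqrt_pos.2 (by positivity)
  have hexp : ∀ σ : ℝ, σ ^ 2 = s ^ 2 →
      ∫⁻ y, ENNReal.ofReal (Real.exp (σ * ∑ i, v i * y i)) ∂(_root_.stdGaussian n) =
      ENNReal.ofReal (Real.exp m) := fun σ hσ => by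
    have := lintegral_exp_linear_stdGaussian (fun i => σ * v i)
    simp_rw [mul_assoc, ← Finset.mul_sum, mul_pow] at this
    rw [this, ← Finset.mul_sum, ← hA, hσ, hs2]
    congr 2; field_simp
  have hpt (z : ℝ) : z ^ (2 * m) ≤
      (2 * m * A) ^ m * (Real.exp (s * z) + Real.exp (-s * z)) := by
    have h := pow_two_mul_le_exp_add_exp_neg m (s * z)
    rw [mul_pow, pow_mul s, hs2] at h
    have e1 : (2 * m * A : ℝ) ^ m * (2 * m / A) ^ m = (2 * m) ^ (2 * m) := by
      rw [← mul_pow, pow_mul]; congr 1; field_simp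
    rw [← e1] at h
    have : 0 < (2 * m / A : ℝ) ^ m := by positivity
    rw [neg_mul]
    refine le_of_mul_le_mul_left ?_ this
    linarith
  calc ∫⁻ y, ENNReal.ofReal ((∑ i, v i * y i) ^ (2 * m)) ∂(_root_.stdGaussian n)
      ≤ ∫⁻ y, ENNReal.ofReal ((2 * m * A) ^ m) *
          (ENNReal.ofReal (Real.exp (s * ∑ i, v i * y i)) +
            ENNReal.ofReal (Real.exp (-s * ∑ i, v i * y i))) ∂(_root_.stdGaussian n) := by
        refine lintegral_mono fun y => ?_
        rw [← ENNReal.ofReal_add (by positivity) (by positivity),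
          ← ENNReal.ofReal_mul (by positivity)]
        exact ENNReal.ofReal_le_ofReal (hpt _)
    _ = ENNReal.ofReal ((2 * m * A) ^ m * (Real.exp m + Real.exp m)) := by
        rw [lintegral_const_mul _ (by fun_prop), lintegral_add_left (by fun_prop),
          hexp s rfl, hexp (-s) (by ring), ← ENNReal.ofReal_add (by positivity) (by positivity),
          ← ENNReal.ofReal_mul (by positivity)]
    _ ≤ _ := by
        refine ENNReal.ofReal_le_ofReal ?_
        have e1 : Real.exp m ≤ 3 ^ m := by
          rw [← Real.exp_one_rpow, Real.rpow_natCast]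
          exact pow_le_pow_left₀ (Real.exp_pos _).le (by linarith [Real.exp_one_lt_d9]) _
        have e2 : (2 : ℝ) ≤ 2 ^ m := by
          calc (2 : ℝ) = 2 ^ 1 := by norm_num
            _ ≤ 2 ^ m := pow_le_pow_right₀ (by norm_num) hm
        calc (2 * m * A) ^ m * (Real.exp m + Real.exp m)
            = (2 * m * A) ^ m * (2 * Real.exp m) := by ring
          _ ≤ (2 * m * A) ^ m * (2 ^ m * 3 ^ m) := by gcongr
          _ = (12 * m * A) ^ m := by rw [← mul_pow, ← mul_pow]; congr 1; ring

lemma integrable_pow_four_mul_exp_gaussianReal :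
    Integrable (fun x : ℝ => x ^ 4 * Real.exp (x ^ 2 / 4)) (gaussianReal 0 1) := by
  rw [gaussianReal_of_var_ne_zero _ one_ne_zero,
    integrable_withDensity_iff (measurable_gaussianPDF _ _)
      (Filter.Eventually.of_forall fun _ => gaussianPDF_lt_top)]
  have h := (integrable_rpow_mul_exp_neg_mul_sq (b := 1 / 4) (by norm_num)
    (s := 4) (by norm_num)).const_mul (Real.sqrt (2 * Real.pi))⁻¹
  refine h.congr (Filter.Eventually.of_forall fun x => ?_)
  have : Real.exp (-(1 / 4) * x ^ 2) = Real.exp (x ^ 2 / 4) * Real.exp (-x ^ 2 / 2) := by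
    rw [← Real.exp_add]; congr 1; ring
  simp only [toReal_gaussianPDF, gaussianPDFReal, this]
  norm_num
  ring

/-- A separable functional comparable to the infimal convolution of `l * ‖·‖₄⁴` and `‖·‖₂²`. -/
noncomputable def quarticQuadratic {n : ℕ} (l : ℝ) (x : Fin n → ℝ) : ℝ :=
  ∑ i, min (l * x i ^ 4) (x i ^ 2)

lemma exists_lintegral_exp_quarticQuadratic_le :
    ∃ K : ℝ, 0 ≤ K ∧ ∀ (n : ℕ) (l : ℝ), 0 ≤ l →
      ∫⁻ x, ENNReal.ofReal (Real.exp (quarticQuadratic l x / 4)) ∂(_root_.stdGaussian n) ≤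
        ENNReal.ofReal (Real.exp (K * l * n)) := by
  set K := ∫ x : ℝ, x ^ 4 * Real.exp (x ^ 2 / 4) ∂(gaussianReal 0 1) with hK
  have hK0 : 0 ≤ K := integral_nonneg fun x => by positivity
  refine ⟨K, hK0, fun n l hl => ?_⟩
  have hpt (x : ℝ) : Real.exp (min (l * x ^ 4) (x ^ 2) / 4) ≤
      1 + l * (x ^ 4 * Real.exp (x ^ 2 / 4)) := by
    set a := min (l * x ^ 4) (x ^ 2) / 4 with ha
    have ha0 : 0 ≤ a := by have : 0 ≤ min (l * x ^ 4) (x ^ 2) := by positivity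
                           positivity
    have h1 : a ≤ l * x ^ 4 := by
      have := min_le_left (l * x ^ 4) (x ^ 2); have : 0 ≤ l * x ^ 4 := by positivity
      linarith
    have h2 : a ≤ x ^ 2 / 4 := by
      have := min_le_right (l * x ^ 4) (x ^ 2); linarith
    have h3 : Real.exp a ≤ 1 + a * Real.exp a := by
      have := Real.add_one_le_exp (-a)
      have h4 : Real.exp (-a) * Real.exp a = 1 := by rw [← Real.exp_add]; simp
      nlinarith [Real.exp_pos a]
    calc Real.exp a ≤ 1 + a * Real.exp a := h3
      _ ≤ 1 + (l * x ^ 4) * Real.exp (x ^ 2 / 4) := by gcongr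
      _ = _ := by ring
  have hintegral : Integrable (fun x : ℝ => 1 + l * (x ^ 4 * Real.exp (x ^ 2 / 4)))
      (gaussianReal 0 1) :=
    (integrable_const 1).add (integrable_pow_four_mul_exp_gaussianReal.const_mul l)
  calc ∫⁻ x, ENNReal.ofReal (Real.exp (quarticQuadratic l x / 4)) ∂(_root_.stdGaussian n)
      ≤ ∫⁻ x, ENNReal.ofReal (∏ i, (1 + l * (x i ^ 4 * Real.exp (x i ^ 2 / 4))))
          ∂(_root_.stdGaussian n) := by
        refine lintegral_mono fun x => ENNReal.ofReal_le_ofReal ?_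
        rw [quarticQuadratic, Finset.sum_div, Real.exp_sum]
        exact Finset.prod_le_prod (fun _ _ => (Real.exp_pos _).le) fun i _ => hpt (x i)
    _ = ENNReal.ofReal (∏ _i : Fin n, (1 + l * K)) := by
        rw [lintegral_stdGaussian_prod (φ := fun _ x => 1 + l * (x ^ 4 * Real.exp (x ^ 2 / 4)))
          (fun _ x => by positivity) (fun _ => hintegral)]
        congr 2
        ext i
        rw [integral_add (integrable_const 1)
          (integrable_pow_four_mul_exp_gaussianReal.const_mul l), integral_const_mul, hK]
        simp
    _ ≤ _ := by
        refine ENNReal.ofReal_le_ofReal ?_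
        rw [Finset.prod_const, Finset.card_univ, Fintype.card_fin,
          show K * l * n = n * (l * K) by ring, Real.exp_nat_mul]
        gcongr
        linarith [Real.add_one_le_exp (l * K)]

/-- The `p`-th power of the Lorentz norm. -/
noncomputable def lorPow {n : ℕ} (r p : ℝ) (x : Fin n → ℝ) : ℝ :=
  ∑ i : Fin n, ((i : ℝ) + 1) ^ (-r) * decRe x i ^ p

/-- A permutation arranging `|x|` in non-increasing order. -/
noncomputable def decPerm {n : ℕ} (x : Fin n → ℝ) : Equiv.Perm (Fin n) :=
  Fin.revPerm.trans (Tuple.sort fun j => |x j|)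

/-- A subgradient of `lorPow r p` at `x`. -/
noncomputable def lorGrad {n : ℕ} (r p : ℝ) (x : Fin n → ℝ) : Fin n → ℝ := fun l =>
  p * (((decPerm x).symm l : ℕ) + 1 : ℝ) ^ (-r) * (|x l| ^ (p - 1) * Real.sign (x l))

lemma decRe_eq {n : ℕ} (x : Fin n → ℝ) (i : Fin n) : decRe x i = |x (decPerm x i)| := rfl

lemma decRe_nonneg {n : ℕ} (x : Fin n → ℝ) (i : Fin n) : 0 ≤ decRe x i := abs_nonneg _

lemma decRe_antitone {n : ℕ} (x : Fin n → ℝ) : Antitone (decRe x) := fun _ _ hij =>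
  Tuple.monotone_sort (fun j => |x j|) (Fin.rev_le_rev.2 hij)

lemma lorPow_nonneg {n : ℕ} (r p : ℝ) (x : Fin n → ℝ) : 0 ≤ lorPow r p x :=
  Finset.sum_nonneg fun i _ => mul_nonneg (by positivity) (Real.rpow_nonneg (decRe_nonneg x i) p)

lemma lorNorm_eq {n : ℕ} (r p : ℝ) (x : Fin n → ℝ) : lorNorm r p x = lorPow r p x ^ (1 / p) := rfl

lemma sum_decPerm {n : ℕ} (x : Fin n → ℝ) (F : ℕ → ℝ → ℝ) :
    ∑ l, F ((decPerm x).symm l) |x l| = ∑ i : Fin n, F i (decRe x i) := by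
  rw [← Equiv.sum_comp (decPerm x)]
  simp [decRe_eq]

lemma lorPow_eq {n : ℕ} (r p : ℝ) (x : Fin n → ℝ) :
    lorPow r p x = ∑ l, (((decPerm x).symm l : ℕ) + 1 : ℝ) ^ (-r) * |x l| ^ p :=
  (sum_decPerm x fun i t => ((i : ℝ) + 1) ^ (-r) * t ^ p).symm

lemma sum_perm_le_lorPow {n : ℕ} {r p : ℝ} (hr : 0 ≤ r) (hp : 0 ≤ p) (x : Fin n → ℝ)
    (σ : Equiv.Perm (Fin n)) :
    ∑ l, ((σ l : ℕ) + 1 : ℝ) ^ (-r) * |x l| ^ p ≤ lorPow r p x := by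
  rw [← Equiv.sum_comp (decPerm x)]
  have hw : Antitone fun i : Fin n => ((i : ℕ) + 1 : ℝ) ^ (-r) := fun i j hij =>
    Real.rpow_le_rpow_of_nonpos (by positivity) (by
      have : (i : ℕ) ≤ j := hij
      have : ((i : ℕ) : ℝ) ≤ (j : ℕ) := by exact_mod_cast this
      linarith) (by linarith)
  have hd : Antitone fun i : Fin n => decRe x i ^ p := fun i j hij =>
    Real.rpow_le_rpow (decRe_nonneg x j) (decRe_antitone x hij) hp
  exact (hw.monovary hd).sum_comp_perm_mul_le_sum_mul (σ := (decPerm x).trans σ)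

lemma abs_rpow_subgradient {p : ℝ} (hp : 1 ≤ p) (a b : ℝ) :
    |a| ^ p + p * (|a| ^ (p - 1) * Real.sign a) * (b - a) ≤ |b| ^ p := by
  rcases eq_or_ne a 0 with rfl | ha
  · simp [Real.zero_rpow (by linarith : p ≠ 0)]
    positivity
  have hA : 0 < |a| := abs_pos.2 ha
  have h1 : Real.sign a * (b - a) ≤ |b| - |a| := by
    rcases lt_or_gt_of_ne ha with h | h
    · rw [Real.sign_of_neg h, abs_of_neg h]; linarith [neg_abs_le b]
    · rw [Real.sign_of_pos h, abs_of_pos h]; linarith [le_abs_self b]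
  have h2 := one_add_mul_self_le_rpow_one_add (s := |b| / |a| - 1)
    (by have : 0 ≤ |b| / |a| := by positivity
        linarith) hp
  rw [add_sub_cancel, Real.div_rpow (abs_nonneg b) hA.le, le_div_iff₀ (by positivity)] at h2
  have h3 : |a| ^ p = |a| ^ (p - 1) * |a| := by
    rw [← Real.rpow_add_one hA.ne']; congr 1; ring
  have h4 : 0 ≤ p * |a| ^ (p - 1) := by positivity
  calc |a| ^ p + p * (|a| ^ (p - 1) * Real.sign a) * (b - a)
      = |a| ^ p + p * |a| ^ (p - 1) * (Real.sign a * (b - a)) := by ring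
    _ ≤ |a| ^ p + p * |a| ^ (p - 1) * (|b| - |a|) := by gcongr
    _ = (1 + p * (|b| / |a| - 1)) * |a| ^ p := by rw [h3]; field_simp
    _ ≤ _ := h2

lemma lorPow_subgradient {n : ℕ} {r p : ℝ} (hr : 0 ≤ r) (hp : 1 ≤ p) (x y : Fin n → ℝ) :
    lorPow r p x + ∑ l, lorGrad r p x l * (y l - x l) ≤ lorPow r p y := by
  refine le_trans ?_ (sum_perm_le_lorPow hr (by linarith) y (decPerm x).symm)
  rw [lorPow_eq, ← Finset.sum_add_distrib]
  refine Finset.sum_le_sum fun l _ => ?_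
  have h := abs_rpow_subgradient hp (x l) (y l)
  have hw : 0 ≤ (((decPerm x).symm l : ℕ) + 1 : ℝ) ^ (-r) := by positivity
  calc _ = (((decPerm x).symm l : ℕ) + 1 : ℝ) ^ (-r) *
        (|x l| ^ p + p * (|x l| ^ (p - 1) * Real.sign (x l)) * (y l - x l)) := by
        rw [lorGrad]; ring
    _ ≤ _ := by gcongr

lemma abs_lorPow_sub_le {n : ℕ} {r p : ℝ} (hr : 0 ≤ r) (hp : 1 ≤ p) (x y : Fin n → ℝ) :
    |lorPow r p y - lorPow r p x| ≤
      |∑ l, lorGrad r p x l * (y l - x l)| + |∑ l, lorGrad r p y l * (x l - y l)| := by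
  have h1 := lorPow_subgradient hr hp x y
  have h2 := lorPow_subgradient hr hp y x
  have a1 := neg_abs_le (∑ l, lorGrad r p x l * (y l - x l))
  have a2 := neg_abs_le (∑ l, lorGrad r p y l * (x l - y l))
  have b1 := abs_nonneg (∑ l, lorGrad r p x l * (y l - x l))
  have b2 := abs_nonneg (∑ l, lorGrad r p y l * (x l - y l))
  rw [abs_le]; constructor <;> linarith

lemma sum_sq_lorGrad_le {n : ℕ} (r p : ℝ) (x : Fin n → ℝ) :
    ∑ l, lorGrad r p x l ^ 2 ≤
      p ^ 2 * ∑ i : Fin n, ((i : ℝ) + 1) ^ (-(2 * r)) * decRe x i ^ (2 * (p - 1)) := by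
  rw [← sum_decPerm x fun i t => ((i : ℝ) + 1) ^ (-(2 * r)) * t ^ (2 * (p - 1)), Finset.mul_sum]
  refine Finset.sum_le_sum fun l _ => ?_
  have e1 : (((decPerm x).symm l : ℕ) + 1 : ℝ) ^ (-(2 * r)) =
      ((((decPerm x).symm l : ℕ) + 1 : ℝ) ^ (-r)) ^ 2 := by
    rw [← Real.rpow_mul_natCast (by positivity)]; congr 1; push_cast; ring
  have e2 : |x l| ^ (2 * (p - 1)) = (|x l| ^ (p - 1)) ^ 2 := by
    rw [← Real.rpow_mul_natCast (by positivity)]; congr 1; push_cast; ring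
  have e3 : Real.sign (x l) ^ 2 ≤ 1 := by
    rcases Real.sign_apply_eq (x l) with h | h | h <;> rw [h] <;> norm_num
  rw [e1, e2, lorGrad]
  calc _ = p ^ 2 * (((((decPerm x).symm l : ℕ) + 1 : ℝ) ^ (-r)) ^ 2 * (|x l| ^ (p - 1)) ^ 2) *
        Real.sign (x l) ^ 2 := by ring
    _ ≤ p ^ 2 * (((((decPerm x).symm l : ℕ) + 1 : ℝ) ^ (-r)) ^ 2 * (|x l| ^ (p - 1)) ^ 2) * 1 := by
        gcongr
    _ = _ := mul_one _

lemma sum_lorGrad_mul_self {n : ℕ} {r p : ℝ} (hp : 1 ≤ p) (x : Fin n → ℝ) :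
    ∑ l, lorGrad r p x l * x l = p * lorPow r p x := by
  rw [lorPow_eq, Finset.mul_sum]
  refine Finset.sum_congr rfl fun l _ => ?_
  have h : |x l| ^ (p - 1) * Real.sign (x l) * x l = |x l| ^ p := by
    rcases eq_or_ne (x l) 0 with h | h
    · simp [h, Real.zero_rpow (by linarith : p ≠ 0)]
    · have : |x l| ^ p = |x l| ^ (p - 1) * |x l| := by
        rw [← Real.rpow_add_one (abs_pos.2 h).ne']; congr 1; ring
      rw [this, mul_assoc]
      congr 1
      rcases lt_or_gt_of_ne h with h | h
      · rw [Real.sign_of_neg h, abs_of_neg h]; ring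
      · rw [Real.sign_of_pos h, abs_of_pos h]; ring
  rw [lorGrad, ← h]; ring

lemma lorPow_le_sum {n : ℕ} {r p : ℝ} (hr : 0 ≤ r) (hp : 0 ≤ p) (hp2 : p ≤ 2) (x : Fin n → ℝ) :
    lorPow r p x ≤ ∑ l, (1 + x l ^ 2) := by
  rw [lorPow_eq]
  refine Finset.sum_le_sum fun l _ => ?_
  have h1 : (((decPerm x).symm l : ℕ) + 1 : ℝ) ^ (-r) ≤ 1 :=
    Real.rpow_le_one_of_one_le_of_nonpos (by simp) (by linarith)
  have h2 : |x l| ^ p ≤ 1 + x l ^ 2 := by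
    rcases le_total |x l| 1 with h | h
    · have := Real.rpow_le_one (abs_nonneg _) h hp
      nlinarith [sq_nonneg (x l)]
    · have := Real.rpow_le_rpow_of_exponent_le h hp2
      rw [Real.rpow_two, sq_abs] at this
      linarith
  calc _ ≤ 1 * (1 + x l ^ 2) := by gcongr
    _ = _ := one_mul _

lemma measurableSet_decPerm_eq {n : ℕ} (σ : Equiv.Perm (Fin n)) :
    MeasurableSet {x : Fin n → ℝ | decPerm x = σ} := by
  have h : ∀ x : Fin n → ℝ, decPerm x = σ ↔
      (∀ i j : Fin n, i ≤ j → |x (σ i.rev)| ≤ |x (σ j.rev)|) ∧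
      ∀ i j : Fin n, i < j → |x (σ i.rev)| = |x (σ j.rev)| → σ i.rev < σ j.rev := by
    intro x
    have e : decPerm x = σ ↔ Fin.revPerm.trans σ = Tuple.sort fun j => |x j| := by
      constructor
      · rintro rfl; ext i; simp [decPerm]
      · intro h; rw [decPerm, ← h]; ext i; simp
    rw [e, Tuple.eq_sort_iff]
    simp [Monotone]
  simp only [h]
  have hm : ∀ i : Fin n, Measurable fun x : Fin n → ℝ => |x i| := fun i =>
    (measurable_pi_apply i).abs
  simp only [Set.ofPred_and, Set.ofPred_forall]
  refine MeasurableSet.inter ?_ ?_ <;>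
    refine MeasurableSet.iInter fun i => MeasurableSet.iInter fun j =>
      MeasurableSet.iInter fun _ => ?_
  · exact measurableSet_le (hm _) (hm _)
  · by_cases hd : σ i.rev < σ j.rev
    · simp [hd]
    · simp only [hd, imp_false]
      exact (measurableSet_eq_fun (hm (σ i.rev)) (hm (σ j.rev))).compl

lemma measurable_lorGrad {n : ℕ} (r p : ℝ) : Measurable (lorGrad r p : (Fin n → ℝ) → _) := by
  refine measurable_pi_lambda _ fun l => ?_
  have h : (fun x : Fin n → ℝ => lorGrad r p x l) = fun x => ∑ σ : Equiv.Perm (Fin n),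
      {x : Fin n → ℝ | decPerm x = σ}.indicator (fun x => p * (((σ).symm l : ℕ) + 1 : ℝ) ^ (-r) *
        (|x l| ^ (p - 1) * Real.sign (x l))) x := by
    ext x
    rw [Finset.sum_eq_single (decPerm x)]
    · simp [lorGrad]
    · intro σ _ hσ
      simp [Set.indicator, hσ.symm]
    · simp
  rw [h]
  refine Finset.measurable_sum _ fun σ _ => Measurable.indicator ?_ (measurableSet_decPerm_eq σ)
  have hs : Measurable Real.sign := by
    unfold Real.sign
    refine Measurable.ite measurableSet_Iio measurable_const
      (Measurable.ite measurableSet_Ioi measurable_const measurable_const)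
  have := hs.comp (measurable_pi_apply (X := fun _ : Fin n => ℝ) l)
  fun_prop

lemma continuous_lorPow {n : ℕ} {r p : ℝ} (hr : 0 ≤ r) (hp : 0 ≤ p) :
    Continuous (lorPow r p : (Fin n → ℝ) → ℝ) := by
  have h : (lorPow r p : (Fin n → ℝ) → ℝ) = fun x =>
      Finset.univ.sup' Finset.univ_nonempty fun σ : Equiv.Perm (Fin n) =>
        ∑ l, ((σ l : ℕ) + 1 : ℝ) ^ (-r) * |x l| ^ p := by
    ext x
    apply le_antisymm
    · rw [lorPow_eq]
      exact Finset.le_sup' (fun σ : Equiv.Perm (Fin n) =>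
        ∑ l, ((σ l : ℕ) + 1 : ℝ) ^ (-r) * |x l| ^ p) (Finset.mem_univ (decPerm x).symm)
    · exact Finset.sup'_le _ _ fun σ _ => sum_perm_le_lorPow hr hp x σ
  rw [h]
  refine Continuous.finset_sup'_apply _ fun σ _ => ?_
  refine continuous_finsetSum _ fun l _ => continuous_const.mul ?_
  exact (continuous_abs.comp (continuous_apply l)).rpow_const fun _ => Or.inr hp

lemma decPerm_smul {n : ℕ} {c : ℝ} (hc : c ≠ 0) (x : Fin n → ℝ) :
    decPerm (fun i => c * x i) = decPerm x := by
  have h : Fin.revPerm.trans (decPerm x) = Tuple.sort fun j => |c * x j| := by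
    rw [Tuple.eq_sort_iff]
    have h0 : Fin.revPerm.trans (decPerm x) = Tuple.sort fun j => |x j| := by
      ext i; simp [decPerm]
    obtain ⟨h1, h2⟩ := Tuple.eq_sort_iff.1 h0
    have hc' : 0 < |c| := abs_pos.2 hc
    refine ⟨fun i j hij => ?_, fun i j hij he => h2 i j hij ?_⟩
    · simpa [abs_mul, hc'] using h1 hij
    · simpa [abs_mul, hc] using he
  rw [decPerm, ← h]; ext i; simp

lemma lorPow_mul {n : ℕ} {r p : ℝ} (hp : 0 < p) (c : ℝ) (x : Fin n → ℝ) :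
    lorPow r p (fun i => c * x i) = |c| ^ p * lorPow r p x := by
  rcases eq_or_ne c 0 with rfl | hc
  · simp [lorPow, decRe_eq, Real.zero_rpow hp.ne']
  · rw [lorPow, lorPow, Finset.mul_sum]
    refine Finset.sum_congr rfl fun i _ => ?_
    rw [decRe_eq, decRe_eq, decPerm_smul hc, abs_mul, Real.mul_rpow (abs_nonneg _) (abs_nonneg _)]
    ring

lemma min_quartic_quadratic_mono {l a b : ℝ} (hl : 0 ≤ l) (ha : 0 ≤ a) (hab : a ≤ b) :
    min (l * a ^ 4) (a ^ 2) ≤ min (l * b ^ 4) (b ^ 2) := by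
  gcongr

lemma quarticQuadratic_eq_sum_decRe {n : ℕ} (l : ℝ) (x : Fin n → ℝ) :
    quarticQuadratic l x = ∑ i, min (l * decRe x i ^ 4) (decRe x i ^ 2) := by
  rw [← sum_decPerm x fun _ a => min (l * a ^ 4) (a ^ 2), quarticQuadratic]
  refine Finset.sum_congr rfl fun i _ => ?_
  rw [sq_abs, show |x i| ^ 4 = x i ^ 4 from Even.pow_abs (by decide) _]

lemma rank_mul_le_quarticQuadratic {n : ℕ} {l : ℝ} (hl : 0 ≤ l) (x : Fin n → ℝ) (i : Fin n) :
    ((i : ℝ) + 1) * min (l * decRe x i ^ 4) (decRe x i ^ 2) ≤ quarticQuadratic l x := by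
  rw [quarticQuadratic_eq_sum_decRe]
  calc _ = ∑ _j ∈ Finset.Iic i, min (l * decRe x i ^ 4) (decRe x i ^ 2) := by
        simp [Fin.card_Iic]
    _ ≤ ∑ j ∈ Finset.Iic i, min (l * decRe x j ^ 4) (decRe x j ^ 2) :=
        Finset.sum_le_sum fun j hj => min_quartic_quadratic_mono hl (decRe_nonneg x i)
          (decRe_antitone x (Finset.mem_Iic.1 hj))
    _ ≤ _ := Finset.sum_le_univ_sum_of_nonneg fun j =>
        le_min (mul_nonneg hl (pow_nonneg (decRe_nonneg x j) 4)) (sq_nonneg _)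

lemma quarticQuadratic_nonneg {n : ℕ} {l : ℝ} (hl : 0 ≤ l) (x : Fin n → ℝ) :
    0 ≤ quarticQuadratic l x :=
  Finset.sum_nonneg fun _ _ => le_min (mul_nonneg hl (by positivity)) (sq_nonneg _)

lemma rank_rpow_mul_le_of_small {n : ℕ} {t μ : ℝ} (ht : 0 ≤ t) (ht1 : t ≤ 1) (hμ : 0 < μ)
    (x : Fin n → ℝ) (i : Fin n) (h : μ / n * decRe x i ^ 2 ≤ 1) :
    ((i : ℝ) + 1) ^ (t - 1) * decRe x i ^ (2 * t) ≤
      (1 + quarticQuadratic (μ / n) x / μ) * ((n : ℝ) ^ (t / 2) * ((i : ℝ) + 1) ^ (t / 2 - 1)) := by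
  have hn : (0 : ℝ) < n := by exact_mod_cast i.pos
  set a := decRe x i with ha
  have ha0 : 0 ≤ a := decRe_nonneg x i
  set W := quarticQuadratic (μ / n) x with hW
  have hW0 : 0 ≤ W := quarticQuadratic_nonneg (by positivity) x
  have h1 := rank_mul_le_quarticQuadratic (l := μ / n) (by positivity) x i
  rw [← ha, ← hW, min_eq_left (by nlinarith [sq_nonneg a])] at h1
  have hj : (0 : ℝ) < (i : ℝ) + 1 := by positivity
  set j : ℝ := (i : ℝ) + 1
  have h2 : a ^ 4 ≤ W / μ * (n / j) := by
    rw [div_mul_div_comm, le_div_iff₀ (by positivity)]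
    calc a ^ 4 * (μ * j) = (j * (μ / n * a ^ 4)) * n := by field_simp
      _ ≤ W * n := by gcongr
  have h3 : a ^ (2 * t) ≤ (1 + W / μ) * (n / j) ^ (t / 2) := by
    calc a ^ (2 * t) = (a ^ 4) ^ (t / 2) := by
          rw [← Real.rpow_natCast, ← Real.rpow_mul ha0]; congr 1; push_cast; ring
      _ ≤ (W / μ * (n / j)) ^ (t / 2) := by gcongr
      _ = (W / μ) ^ (t / 2) * (n / j) ^ (t / 2) := Real.mul_rpow (by positivity) (by positivity)
      _ ≤ (1 + W / μ) ^ (t / 2) * (n / j) ^ (t / 2) := by gcongr; linarith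
      _ ≤ (1 + W / μ) * (n / j) ^ (t / 2) := by
          gcongr
          exact Real.rpow_le_self_of_one_le (by have : 0 ≤ W / μ := by positivity
                                                linarith) (by linarith)
  calc j ^ (t - 1) * a ^ (2 * t) ≤ j ^ (t - 1) * ((1 + W / μ) * (n / j) ^ (t / 2)) := by gcongr
    _ = _ := by
      have : j ^ (t - 1) = j ^ (t / 2 - 1) * j ^ (t / 2) := by
        rw [← Real.rpow_add hj]; congr 1; ring
      rw [this, Real.div_rpow hn.le hj.le]
      field_simp

lemma rank_rpow_mul_le_of_large {n : ℕ} {t μ H : ℝ} (ht : 0 ≤ t) (ht1 : t ≤ 1) (hμ : 0 < μ)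
    (hH : 0 < H) (x : Fin n → ℝ) (i : Fin n) (h : 1 ≤ μ / n * decRe x i ^ 2) :
    ((i : ℝ) + 1) ^ (t - 1) * decRe x i ^ (2 * t) ≤
      μ ^ t * H ^ (1 - t) * (1 / (((i : ℝ) + 1) * H) +
        min (μ / n * decRe x i ^ 4) (decRe x i ^ 2) / μ) := by
  set a := decRe x i with ha
  have ha0 : 0 ≤ a := decRe_nonneg x i
  rw [min_eq_right (by nlinarith [sq_nonneg a])]
  have hj : (0 : ℝ) < (i : ℝ) + 1 := by positivity
  set j : ℝ := (i : ℝ) + 1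
  have h1 := Real.geom_mean_le_arith_mean2_weighted (w₁ := 1 - t) (w₂ := t) (p₁ := 1 / (j * H))
    (p₂ := a ^ 2 / μ) (by linarith) ht (by positivity) (by positivity) (by ring)
  have e : j ^ (t - 1) * a ^ (2 * t) =
      μ ^ t * H ^ (1 - t) * ((1 / (j * H)) ^ (1 - t) * (a ^ 2 / μ) ^ t) := by
    rw [Real.div_rpow (by positivity) hμ.le, one_div, Real.inv_rpow (by positivity),
      Real.mul_rpow hj.le hH.le, show t - 1 = -(1 - t) by ring, Real.rpow_neg hj.le,
      show a ^ (2 * t) = (a ^ 2) ^ t by rw [← Real.rpow_two, ← Real.rpow_mul ha0]]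
    have := Real.rpow_pos_of_pos hμ t
    have := Real.rpow_pos_of_pos hH (1 - t)
    field_simp
  rw [e]
  refine mul_le_mul_of_nonneg_left (h1.trans ?_) (by positivity)
  have h2 : 0 ≤ 1 / (j * H) := by positivity
  have h3 : 0 ≤ a ^ 2 / μ := by positivity
  nlinarith

lemma sum_rank_rpow_mul_le {n : ℕ} {t μ H : ℝ} (ht : 0 ≤ t) (ht1 : t ≤ 1) (hμ : 0 < μ)
    (hH : 0 < H) (hH' : ∑ i : Fin n, 1 / ((i : ℝ) + 1) ≤ H) (x : Fin n → ℝ) :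
    ∑ i : Fin n, ((i : ℝ) + 1) ^ (t - 1) * decRe x i ^ (2 * t) ≤
      (1 + quarticQuadratic (μ / n) x / μ) *
        ((n : ℝ) ^ (t / 2) * ∑ i : Fin n, ((i : ℝ) + 1) ^ (t / 2 - 1) + μ ^ t * H ^ (1 - t)) := by
  set W := quarticQuadratic (μ / n) x with hW
  have hW0 : 0 ≤ W := quarticQuadratic_nonneg (by positivity) x
  have hW1 : 0 ≤ W / μ := by positivity
  have key : ∀ i : Fin n, ((i : ℝ) + 1) ^ (t - 1) * decRe x i ^ (2 * t) ≤
      (1 + W / μ) * ((n : ℝ) ^ (t / 2) * ((i : ℝ) + 1) ^ (t / 2 - 1)) +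
      μ ^ t * H ^ (1 - t) * (1 / (((i : ℝ) + 1) * H) +
        min (μ / n * decRe x i ^ 4) (decRe x i ^ 2) / μ) := by
    intro i
    have p1 : 0 ≤ (1 + W / μ) * ((n : ℝ) ^ (t / 2) * ((i : ℝ) + 1) ^ (t / 2 - 1)) := by positivity
    have p2 : 0 ≤ μ ^ t * H ^ (1 - t) * (1 / (((i : ℝ) + 1) * H) +
        min (μ / n * decRe x i ^ 4) (decRe x i ^ 2) / μ) := by
      have : 0 ≤ min (μ / n * decRe x i ^ 4) (decRe x i ^ 2) := by positivity
      positivity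
    rcases le_total (μ / n * decRe x i ^ 2) 1 with h | h
    · linarith [rank_rpow_mul_le_of_small ht ht1 hμ x i h]
    · linarith [rank_rpow_mul_le_of_large ht ht1 hμ hH x i h]
  refine (Finset.sum_le_sum fun i _ => key i).trans ?_
  rw [Finset.sum_add_distrib, ← Finset.mul_sum, ← Finset.mul_sum, ← Finset.mul_sum,
    Finset.sum_add_distrib, ← Finset.sum_div, ← quarticQuadratic_eq_sum_decRe, ← hW, mul_add]
  have h1 : ∑ i : Fin n, 1 / (((i : ℝ) + 1) * H) ≤ 1 := by
    simp only [← div_div]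
    rw [← Finset.sum_div]
    exact (div_le_one hH).2 hH'
  have h2 : 0 ≤ μ ^ t * H ^ (1 - t) := by positivity
  nlinarith

lemma sum_one_div_le_two_mul_log {n : ℕ} (hn : 3 ≤ n) :
    ∑ i : Fin n, 1 / ((i : ℝ) + 1) ≤ 2 * Real.log n := by
  have h := harmonic_le_one_add_log n
  rw [Fin.sum_univ_eq_sum_range (fun i => 1 / ((i : ℝ) + 1))]
  have e : ((harmonic n : ℚ) : ℝ) = ∑ i ∈ Finset.range n, 1 / ((i : ℝ) + 1) := by
    simp [harmonic]
  have h1 : 1 ≤ Real.log n := by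
    rw [Real.le_log_iff_exp_le (by positivity)]
    have : (3 : ℝ) ≤ n := by exact_mod_cast hn
    linarith [Real.exp_one_lt_d9]
  linarith

lemma mul_sum_rpow_le {s : ℝ} (hs : 0 ≤ s) (hs1 : s ≤ 1) (n : ℕ) :
    s * ∑ i : Fin n, ((i : ℝ) + 1) ^ (s - 1) ≤ (n : ℝ) ^ s := by
  rw [Fin.sum_univ_eq_sum_range (fun i => ((i : ℝ) + 1) ^ (s - 1))]
  induction n with
  | zero => simp [Real.rpow_nonneg]
  | succ n ih =>
    rw [Finset.sum_range_succ, mul_add]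
    push_cast
    have hj : (0 : ℝ) < (n : ℝ) + 1 := by positivity
    have h := rpow_one_add_le_one_add_mul_self (s := -1 / ((n : ℝ) + 1)) (p := s)
      (by rw [le_div_iff₀ hj]; linarith [(Nat.cast_nonneg n : (0 : ℝ) ≤ n)]) hs hs1
    have e1 : 1 + -1 / ((n : ℝ) + 1) = n / (n + 1) := by field_simp; ring
    rw [e1, Real.div_rpow (by positivity) hj.le, div_le_iff₀ (by positivity)] at h
    have e2 : ((n : ℝ) + 1) ^ (s - 1) = (n + 1) ^ s / (n + 1) := by
      rw [Real.rpow_sub_one hj.ne']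
    rw [e2]
    have : (1 + s * (-1 / ((n : ℝ) + 1))) * (n + 1) ^ s = (n + 1) ^ s - s * ((n + 1) ^ s / (n + 1)) := by
      field_simp
      ring
    linarith

lemma rpow_mul_sum_rpow_le {n : ℕ} {t : ℝ} (hn : 3 ≤ n) (ht : 0 ≤ t) (ht1 : t ≤ 1) :
    (n : ℝ) ^ (t / 2) * ∑ i : Fin n, ((i : ℝ) + 1) ^ (t / 2 - 1) ≤
      (n : ℝ) ^ t * (4 * Real.log n / (1 + t * Real.log n)) := by
  have hn0 : (0 : ℝ) < n := by positivity
  have hL : 0 ≤ Real.log n := Real.log_natCast_nonneg n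
  set S := ∑ i : Fin n, ((i : ℝ) + 1) ^ (t / 2 - 1)
  have h1 : t / 2 * S ≤ (n : ℝ) ^ (t / 2) := mul_sum_rpow_le (by linarith) (by linarith) n
  have h2 : S ≤ (n : ℝ) ^ (t / 2) * (2 * Real.log n) := by
    refine le_trans ?_ (mul_le_mul_of_nonneg_left (sum_one_div_le_two_mul_log hn) (by positivity))
    rw [Finset.mul_sum]
    refine Finset.sum_le_sum fun i _ => ?_
    rw [Real.rpow_sub_one (by positivity), ← mul_one_div]
    gcongr
    exact_mod_cast i.isLt
  have e : (n : ℝ) ^ t = (n : ℝ) ^ (t / 2) * (n : ℝ) ^ (t / 2) := by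
    rw [← Real.rpow_add hn0]; congr 1; ring
  rw [e, mul_assoc]
  gcongr
  rw [mul_div_assoc', le_div_iff₀ (by positivity)]
  nlinarith

/-- The bound on the squared length of the subgradient used in the moment estimates. -/
noncomputable def gradBound (n : ℕ) (t μ : ℝ) : ℝ :=
  (n : ℝ) ^ t * (4 * Real.log n / (1 + t * Real.log n)) + μ ^ t * (2 * Real.log n) ^ (1 - t)

lemma gradBound_nonneg {n : ℕ} {t μ : ℝ} (ht : 0 ≤ t) (hμ : 0 ≤ μ) : 0 ≤ gradBound n t μ := by
  have hL : 0 ≤ Real.log n := Real.log_natCast_nonneg n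
  unfold gradBound
  positivity

lemma sum_sq_lorGrad_le_gradBound {n : ℕ} {r p μ : ℝ} (hn : 3 ≤ n) (hp : 1 ≤ p) (hp2 : p ≤ 2)
    (hrp : p = 2 - 2 * r) (hμ : 0 < μ) (x : Fin n → ℝ) :
    ∑ l, lorGrad r p x l ^ 2 ≤
      4 * gradBound n (p - 1) μ * (1 + quarticQuadratic (μ / n) x / μ) := by
  have hL : 0 < Real.log n := Real.log_pos (by exact_mod_cast (by omega : 1 < n))
  have h1 := sum_rank_rpow_mul_le (t := p - 1) (μ := μ) (H := 2 * Real.log n) (by linarith)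
    (by linarith) hμ (by positivity) (sum_one_div_le_two_mul_log hn) x
  have h2 := rpow_mul_sum_rpow_le (t := p - 1) hn (by linarith) (by linarith)
  have h3 := sum_sq_lorGrad_le r p x
  rw [show -(2 * r) = p - 1 - 1 by rw [hrp]; ring] at h3
  have hW0 := quarticQuadratic_nonneg (l := μ / n) (by positivity) x
  calc _ ≤ p ^ 2 * _ := h3
    _ ≤ 2 ^ 2 * ((1 + quarticQuadratic (μ / n) x / μ) * gradBound n (p - 1) μ) := by
        gcongr
        · exact Finset.sum_nonneg fun i _ => mul_nonneg (by positivity)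
            (Real.rpow_nonneg (decRe_nonneg x i) _)
        · refine h1.trans ?_
          gcongr
          unfold gradBound
          gcongr
    _ = _ := by ring

/-- Moments of the length of the subgradient at a Gaussian point. -/
lemma exists_lintegral_sum_sq_lorGrad_pow_le : ∃ K : ℝ, 0 < K ∧ ∀ (n m : ℕ) (r p : ℝ), 3 ≤ n →
    1 ≤ m → 1 ≤ p → p ≤ 2 → p = 2 - 2 * r →
    ∫⁻ x, ENNReal.ofReal ((∑ l, lorGrad r p x l ^ 2) ^ m) ∂_root_.stdGaussian n ≤
      ENNReal.ofReal ((K * gradBound n (p - 1) m) ^ m) := by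
  obtain ⟨K, hK, h⟩ := exists_lintegral_exp_quarticQuadratic_le
  refine ⟨16 * Real.exp K, by positivity, fun n m r p hn hm hp hp2 hrp => ?_⟩
  have hm0 : (0 : ℝ) < m := by exact_mod_cast hm
  have hn0 : (0 : ℝ) < n := by positivity
  have hR : 0 ≤ gradBound n (p - 1) m := gradBound_nonneg (by linarith) hm0.le
  have key : ∀ x : Fin n → ℝ, (∑ l, lorGrad r p x l ^ 2) ^ m ≤
      (16 * gradBound n (p - 1) m) ^ m * Real.exp (quarticQuadratic (m / n) x / 4) := by
    intro x
    set W := quarticQuadratic ((m : ℝ) / n) x with hW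
    have hW0 : 0 ≤ W := quarticQuadratic_nonneg (by positivity) x
    have h1 : 1 + W / m ≤ 4 * Real.exp (W / (4 * m)) := by
      have := Real.add_one_le_exp (W / (4 * m))
      have e : W / m = 4 * (W / (4 * m)) := by field_simp
      linarith
    calc (∑ l, lorGrad r p x l ^ 2) ^ m
        ≤ (4 * gradBound n (p - 1) m * (1 + W / m)) ^ m :=
          pow_le_pow_left₀ (Finset.sum_nonneg fun _ _ => sq_nonneg _)
            (sum_sq_lorGrad_le_gradBound hn hp hp2 hrp hm0 x) m
      _ ≤ (4 * gradBound n (p - 1) m * (4 * Real.exp (W / (4 * m)))) ^ m := by gcongr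
      _ = (16 * gradBound n (p - 1) m) ^ m * Real.exp (W / (4 * m)) ^ m := by
          rw [← mul_pow]; ring
      _ = _ := by
          rw [← Real.exp_nat_mul]; congr 2; field_simp
  calc _ ≤ ∫⁻ x, ENNReal.ofReal ((16 * gradBound n (p - 1) m) ^ m) *
        ENNReal.ofReal (Real.exp (quarticQuadratic (m / n) x / 4)) ∂_root_.stdGaussian n := by
        refine lintegral_mono fun x => ?_
        rw [← ENNReal.ofReal_mul (by positivity)]
        exact ENNReal.ofReal_le_ofReal (key x)
    _ = ENNReal.ofReal ((16 * gradBound n (p - 1) m) ^ m) *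
        ∫⁻ x, ENNReal.ofReal (Real.exp (quarticQuadratic (m / n) x / 4)) ∂_root_.stdGaussian n :=
        lintegral_const_mul' _ _ ENNReal.ofReal_ne_top
    _ ≤ ENNReal.ofReal ((16 * gradBound n (p - 1) m) ^ m) *
        ENNReal.ofReal (Real.exp (K * (m / n) * n)) := by
        gcongr
        exact h n _ (by positivity)
    _ = _ := by
        rw [← ENNReal.ofReal_mul (by positivity)]
        congr 1
        rw [show K * (m / n) * n = m * K by field_simp, Real.exp_nat_mul, ← mul_pow]
        ring

lemma eLpNorm_two_mul_le_iff {α : Type*} [MeasurableSpace α] {μ : Measure α} {f : α → ℝ} {m : ℕ}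
    (hm : 1 ≤ m) {b : ℝ≥0∞} :
    eLpNorm f ((2 * m : ℕ) : ℝ≥0∞) μ ≤ b ↔
      ∫⁻ x, ENNReal.ofReal (f x ^ (2 * m)) ∂μ ≤ b ^ (2 * m) := by
  have h0 : ((2 * m : ℕ) : ℝ≥0∞) ≠ 0 := by
    simp; omega
  rw [eLpNorm_eq_lintegral_rpow_enorm_toReal h0 (ENNReal.natCast_ne_top _), ENNReal.toReal_natCast]
  have h1 : (0 : ℝ) < (2 * m : ℕ) := by exact_mod_cast (by omega : 0 < 2 * m)
  rw [one_div, ENNReal.rpow_inv_le_iff h1, ENNReal.rpow_natCast]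
  have : ∀ x, ‖f x‖ₑ ^ ((2 * m : ℕ) : ℝ) = ENNReal.ofReal (f x ^ (2 * m)) := by
    intro x
    rw [ENNReal.rpow_natCast, ← ofReal_norm, ← ENNReal.ofReal_pow (norm_nonneg _), Real.norm_eq_abs,
      Even.pow_abs (even_two_mul m)]
  simp only [this]

lemma memLp_eval_sq_stdGaussian {n : ℕ} (i : Fin n) (m : ℕ) :
    MemLp (fun x : Fin n → ℝ => x i ^ 2) m (_root_.stdGaussian n) := by
  have h1 : MemLp (fun x : Fin n → ℝ => x i) ((2 * m : ℕ) : ℝ≥0∞) (_root_.stdGaussian n) :=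
    (memLp_id_gaussianReal' ((2 * m : ℕ) : ℝ≥0∞) (ENNReal.natCast_ne_top _)).comp_measurePreserving
      (measurePreserving_eval (fun _ : Fin n => gaussianReal 0 1) i)
  have h2 := h1.norm_rpow_div 2
  have e : ((2 * m : ℕ) : ℝ≥0∞) / 2 = m := by
    rw [Nat.cast_mul, mul_comm]; exact ENNReal.mul_div_cancel_right (by simp) (by simp)
  rw [e] at h2
  simpa using h2

lemma memLp_lorPow {n : ℕ} {r p : ℝ} (hr : 0 ≤ r) (hp : 0 ≤ p) (hp2 : p ≤ 2) (m : ℕ) :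
    MemLp (lorPow r p : (Fin n → ℝ) → ℝ) m (_root_.stdGaussian n) := by
  have h : MemLp (fun x : Fin n → ℝ => ∑ l, (1 + x l ^ 2)) m (_root_.stdGaussian n) :=
    memLp_finsetSum _ fun l _ => by
      have h1 : MemLp (fun _ : Fin n → ℝ => (1 : ℝ)) m (_root_.stdGaussian n) := memLp_const 1
      exact h1.add (memLp_eval_sq_stdGaussian l m)
  refine h.mono (continuous_lorPow hr hp).aestronglyMeasurable (Filter.Eventually.of_forall fun x => ?_)
  rw [Real.norm_of_nonneg (lorPow_nonneg r p x)]
  exact (lorPow_le_sum hr hp hp2 x).trans (le_abs_self _)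

/-- The `L^q` norm of the subgradient paired with an independent Gaussian vector. -/
noncomputable def gradMoment (n : ℕ) (r p : ℝ) (m : ℕ) : ℝ≥0∞ :=
  eLpNorm (fun z : (Fin n → ℝ) × (Fin n → ℝ) => ∑ l, lorGrad r p z.1 l * z.2 l)
    ((2 * m : ℕ) : ℝ≥0∞) ((_root_.stdGaussian n).prod (_root_.stdGaussian n))

/-- The `L^q` norm of the subgradient paired with its base point. -/
noncomputable def radialMoment (n : ℕ) (r p : ℝ) (m : ℕ) : ℝ≥0∞ :=
  eLpNorm (fun x : Fin n → ℝ => ∑ l, lorGrad r p x l * x l)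
    ((2 * m : ℕ) : ℝ≥0∞) (_root_.stdGaussian n)

lemma measurable_lorGrad_apply {n : ℕ} (r p : ℝ) (l : Fin n) :
    Measurable fun x : Fin n → ℝ => lorGrad r p x l :=
  (measurable_pi_apply l).comp (measurable_lorGrad r p)

lemma measurable_sum_lorGrad_mul {n : ℕ} (r p : ℝ) :
    Measurable fun z : (Fin n → ℝ) × (Fin n → ℝ) => ∑ l, lorGrad r p z.1 l * z.2 l :=
  Finset.measurable_sum _ fun l _ =>
    ((measurable_lorGrad_apply r p l).comp measurable_fst).mul
      ((measurable_pi_apply l).comp measurable_snd)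

lemma radialMoment_ne_top {n : ℕ} {r p : ℝ} (hr : 0 ≤ r) (hp : 1 ≤ p) (hp2 : p ≤ 2) (m : ℕ) :
    radialMoment n r p m ≠ ∞ := by
  unfold radialMoment
  simp only [sum_lorGrad_mul_self hp]
  exact ((memLp_lorPow hr (by linarith) hp2 (2 * m)).const_mul p).eLpNorm_ne_top

lemma exists_gradMoment_le : ∃ K : ℝ, 0 < K ∧ ∀ (n m : ℕ) (r p : ℝ), 3 ≤ n →
    1 ≤ m → 1 ≤ p → p ≤ 2 → p = 2 - 2 * r →
    gradMoment n r p m ≤ ENNReal.ofReal (Real.sqrt (K * m * gradBound n (p - 1) m)) := by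
  obtain ⟨K, hK, h⟩ := exists_lintegral_sum_sq_lorGrad_pow_le
  refine ⟨12 * K, by positivity, fun n m r p hn hm hp hp2 hrp => ?_⟩
  have hR : 0 ≤ gradBound n (p - 1) m := gradBound_nonneg (by linarith) (by positivity)
  unfold gradMoment
  rw [eLpNorm_two_mul_le_iff hm, lintegral_prod _ (by
    exact ((measurable_sum_lorGrad_mul r p).pow_const _).ennreal_ofReal.aemeasurable)]
  calc _ ≤ ∫⁻ x, ENNReal.ofReal ((12 * m : ℝ) ^ m) *
        ENNReal.ofReal ((∑ l, lorGrad r p x l ^ 2) ^ m) ∂_root_.stdGaussian n := by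
        refine lintegral_mono fun x => ?_
        rw [← ENNReal.ofReal_mul (by positivity), ← mul_pow]
        exact lintegral_linear_pow_stdGaussian_le (lorGrad r p x) hm
    _ = ENNReal.ofReal ((12 * m : ℝ) ^ m) *
        ∫⁻ x, ENNReal.ofReal ((∑ l, lorGrad r p x l ^ 2) ^ m) ∂_root_.stdGaussian n :=
        lintegral_const_mul' _ _ ENNReal.ofReal_ne_top
    _ ≤ ENNReal.ofReal ((12 * m : ℝ) ^ m) *
        ENNReal.ofReal ((K * gradBound n (p - 1) m) ^ m) := by
        gcongr
        exact h n m r p hn hm hp hp2 hrp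
    _ = _ := by
        rw [← ENNReal.ofReal_mul (by positivity), ← ENNReal.ofReal_pow (Real.sqrt_nonneg _),
          pow_mul, Real.sq_sqrt (by positivity), ← mul_pow]
        congr 2
        ring

lemma mulVec_add_smul {n k : ℕ} (g : Fin n → Fin k → ℝ) (a b : ℝ) (u v : Fin k → ℝ) (i : Fin n) :
    mulVec g (fun j => a * u j + b * v j) i = a * mulVec g u i + b * mulVec g v i := by
  simp only [mulVec, Finset.mul_sum, ← Finset.sum_add_distrib]
  exact Finset.sum_congr rfl fun j _ => by ring

lemma measurable_lorPow_mulVec {n k : ℕ} {r p : ℝ} (hr : 0 ≤ r) (hp : 0 ≤ p) (u : Fin k → ℝ) :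
    Measurable fun g : Fin n → Fin k → ℝ => lorPow r p (mulVec g u) :=
  (continuous_lorPow hr hp).measurable.comp (measurable_mulVec_left u)

lemma eLpNorm_lorGrad_rotation_le {n k m : ℕ} {r p : ℝ} (hm : 1 ≤ m) (c s : ℝ) {u v : Fin k → ℝ}
    (hu : ∑ j, u j ^ 2 = 1) (hv : ∑ j, v j ^ 2 = 1) (huv : ∑ j, u j * v j = 0) :
    eLpNorm (fun g => ∑ l, lorGrad r p (mulVec g u) l *
      ((c - 1) * mulVec g u l + s * mulVec g v l)) ((2 * m : ℕ) : ℝ≥0∞) (gaussMatrix n k) ≤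
      ‖c - 1‖ₑ * radialMoment n r p m + ‖s‖ₑ * gradMoment n r p m := by
  have hm' : (1 : ℝ≥0∞) ≤ ((2 * m : ℕ) : ℝ≥0∞) := by exact_mod_cast (by omega : 1 ≤ 2 * m)
  have hg : ∀ l, Measurable fun g : Fin n → Fin k → ℝ => lorGrad r p (mulVec g u) l := fun l =>
    (measurable_lorGrad_apply r p l).comp (measurable_mulVec_left u)
  have hx : ∀ (w : Fin k → ℝ) (l : Fin n), Measurable fun g : Fin n → Fin k → ℝ => mulVec g w l :=
    fun w l => (measurable_pi_apply l).comp (measurable_mulVec_left w)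
  have hs : ∀ w : Fin k → ℝ, Measurable fun g : Fin n → Fin k → ℝ =>
      ∑ l, lorGrad r p (mulVec g u) l * mulVec g w l := fun w =>
    Finset.measurable_sum _ fun l _ => (hg l).mul (hx w l)
  have e : (fun g : Fin n → Fin k → ℝ => ∑ l, lorGrad r p (mulVec g u) l *
      ((c - 1) * mulVec g u l + s * mulVec g v l)) =
      (c - 1) • (fun g => ∑ l, lorGrad r p (mulVec g u) l * mulVec g u l) +
      s • (fun g => ∑ l, lorGrad r p (mulVec g u) l * mulVec g v l) := by
    ext g
    simp only [Pi.add_apply, Pi.smul_apply, smul_eq_mul, Finset.mul_sum, ← Finset.sum_add_distrib]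
    exact Finset.sum_congr rfl fun l _ => by ring
  rw [e]
  refine (eLpNorm_add_le ((hs u).const_smul _).aestronglyMeasurable
    ((hs v).const_smul _).aestronglyMeasurable hm').trans ?_
  rw [eLpNorm_const_smul, eLpNorm_const_smul]
  refine le_of_eq (congrArg₂ _ (congrArg _ ?_) (congrArg _ ?_))
  · rw [radialMoment, ← map_gaussMatrix_mulVec hu, eLpNorm_map_measure _
      (measurable_mulVec_left u).aemeasurable]
    · rfl
    · exact (Finset.measurable_sum _ fun l _ => (measurable_lorGrad_apply r p l).mul
        (measurable_pi_apply l)).aestronglyMeasurable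
  · rw [gradMoment, ← map_gaussMatrix_mulVec_pair hu hv huv, eLpNorm_map_measure
      (measurable_sum_lorGrad_mul r p).aestronglyMeasurable
      ((measurable_mulVec_left u).prodMk (measurable_mulVec_left v)).aemeasurable]
    rfl

lemma eLpNorm_lorPow_rotation_le {n k m : ℕ} {r p : ℝ} (hm : 1 ≤ m) (hr : 0 ≤ r) (hp : 1 ≤ p)
    {c s : ℝ} (hcs : c ^ 2 + s ^ 2 = 1) {u v : Fin k → ℝ}
    (hu : ∑ j, u j ^ 2 = 1) (hv : ∑ j, v j ^ 2 = 1) (huv : ∑ j, u j * v j = 0) :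
    eLpNorm (fun g => lorPow r p (mulVec g fun j => c * u j + s * v j) - lorPow r p (mulVec g u))
      ((2 * m : ℕ) : ℝ≥0∞) (gaussMatrix n k) ≤
      2 * (‖c - 1‖ₑ * radialMoment n r p m + ‖s‖ₑ * gradMoment n r p m) := by
  have hm' : (1 : ℝ≥0∞) ≤ ((2 * m : ℕ) : ℝ≥0∞) := by exact_mod_cast (by omega : 1 ≤ 2 * m)
  set u' : Fin k → ℝ := fun j => c * u j + s * v j with hu'
  set v' : Fin k → ℝ := fun j => -s * u j + c * v j with hv'
  have n1 : ∑ j, u' j ^ 2 = 1 := by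
    have : ∀ j, u' j ^ 2 = c ^ 2 * u j ^ 2 + 2 * c * s * (u j * v j) + s ^ 2 * v j ^ 2 := fun j => by
      simp only [hu']; ring
    simp only [this, Finset.sum_add_distrib, ← Finset.mul_sum, hu, hv, huv]; linarith
  have n2 : ∑ j, v' j ^ 2 = 1 := by
    have : ∀ j, v' j ^ 2 = s ^ 2 * u j ^ 2 + -(2 * c * s) * (u j * v j) + c ^ 2 * v j ^ 2 :=
      fun j => by simp only [hv']; ring
    simp only [this, Finset.sum_add_distrib, ← Finset.mul_sum, hu, hv, huv]; linarith
  have n3 : ∑ j, u' j * v' j = 0 := by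
    have : ∀ j, u' j * v' j = -(c * s) * u j ^ 2 + (c ^ 2 - s ^ 2) * (u j * v j) +
        (c * s) * v j ^ 2 := fun j => by simp only [hu', hv']; ring
    simp only [this, Finset.sum_add_distrib, ← Finset.mul_sum, hu, hv, huv]; ring
  have d1 : ∀ (g : Fin n → Fin k → ℝ) l, mulVec g u' l - mulVec g u l =
      (c - 1) * mulVec g u l + s * mulVec g v l := fun g l => by
    rw [hu', mulVec_add_smul]; ring
  have d2 : ∀ (g : Fin n → Fin k → ℝ) l, mulVec g u l - mulVec g u' l =
      (c - 1) * mulVec g u' l + -s * mulVec g v' l := fun g l => by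
    rw [hu', hv', mulVec_add_smul, mulVec_add_smul]
    linear_combination (-(mulVec g u l)) * hcs
  have b1 := eLpNorm_lorGrad_rotation_le (n := n) (r := r) (p := p) hm c s hu hv huv
  have b2 := eLpNorm_lorGrad_rotation_le (n := n) (r := r) (p := p) hm c (-s) n1 n2 n3
  have hmeas : ∀ (w z : Fin k → ℝ) (a b : ℝ), AEStronglyMeasurable (fun g : Fin n → Fin k → ℝ =>
      ∑ l, lorGrad r p (mulVec g w) l * (a * mulVec g w l + b * mulVec g z l))
      (gaussMatrix n k) := fun w z a b => by
    refine (Finset.measurable_sum _ fun l _ => ?_).aestronglyMeasurable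
    have h1 := (measurable_lorGrad_apply r p l).comp (measurable_mulVec_left (n := n) w)
    have h2 := (measurable_pi_apply l).comp (measurable_mulVec_left (n := n) w)
    have h3 := (measurable_pi_apply l).comp (measurable_mulVec_left (n := n) z)
    exact h1.mul ((h2.const_mul a).add (h3.const_mul b))
  have key := eLpNorm_add_le (hmeas u v (c - 1) s).norm (hmeas u' v' (c - 1) (-s)).norm hm'
  rw [eLpNorm_norm, eLpNorm_norm] at key
  calc _ ≤ _ := eLpNorm_mono_real fun g => ?_
    _ ≤ _ := key
    _ ≤ _ := add_le_add b1 b2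
    _ = _ := by rw [enorm_neg, two_mul]
  have := abs_lorPow_sub_le hr hp (mulVec g u) (mulVec g u')
  simp only [d1, d2] at this
  exact this

/-- The point at angle `θ` on the great circle through `u` and `v`. -/
noncomputable def arcPoint {k : ℕ} (u v : Fin k → ℝ) (θ : ℝ) : Fin k → ℝ :=
  fun j => Real.cos θ * u j + Real.sin θ * v j

lemma eLpNorm_lorPow_arc_step_le {n k m : ℕ} {r p : ℝ} (hm : 1 ≤ m) (hr : 0 ≤ r) (hp : 1 ≤ p)
    {u v : Fin k → ℝ} (hu : ∑ j, u j ^ 2 = 1) (hv : ∑ j, v j ^ 2 = 1) (huv : ∑ j, u j * v j = 0)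
    (θ δ : ℝ) :
    eLpNorm (fun g => lorPow r p (mulVec g (arcPoint u v (θ + δ))) -
        lorPow r p (mulVec g (arcPoint u v θ))) ((2 * m : ℕ) : ℝ≥0∞) (gaussMatrix n k) ≤
      2 * (‖Real.cos δ - 1‖ₑ * radialMoment n r p m + ‖Real.sin δ‖ₑ * gradMoment n r p m) := by
  have hcs := Real.cos_sq_add_sin_sq θ
  have n1 : ∑ j, arcPoint u v θ j ^ 2 = 1 := by
    have : ∀ j, arcPoint u v θ j ^ 2 = Real.cos θ ^ 2 * u j ^ 2 +
        2 * Real.cos θ * Real.sin θ * (u j * v j) + Real.sin θ ^ 2 * v j ^ 2 := fun j => by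
      simp only [arcPoint]; ring
    simp only [this, Finset.sum_add_distrib, ← Finset.mul_sum, hu, hv, huv]; linarith
  have n2 : ∑ j, (-Real.sin θ * u j + Real.cos θ * v j) ^ 2 = 1 := by
    have : ∀ j, (-Real.sin θ * u j + Real.cos θ * v j) ^ 2 = Real.sin θ ^ 2 * u j ^ 2 +
        -(2 * Real.cos θ * Real.sin θ) * (u j * v j) + Real.cos θ ^ 2 * v j ^ 2 := fun j => by ring
    simp only [this, Finset.sum_add_distrib, ← Finset.mul_sum, hu, hv, huv]; linarith
  have n3 : ∑ j, arcPoint u v θ j * (-Real.sin θ * u j + Real.cos θ * v j) = 0 := by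
    have : ∀ j, arcPoint u v θ j * (-Real.sin θ * u j + Real.cos θ * v j) =
        -(Real.cos θ * Real.sin θ) * u j ^ 2 + (Real.cos θ ^ 2 - Real.sin θ ^ 2) * (u j * v j) +
        (Real.cos θ * Real.sin θ) * v j ^ 2 := fun j => by simp only [arcPoint]; ring
    simp only [this, Finset.sum_add_distrib, ← Finset.mul_sum, hu, hv, huv]; ring
  have e : arcPoint u v (θ + δ) = fun j => Real.cos δ * arcPoint u v θ j +
      Real.sin δ * (-Real.sin θ * u j + Real.cos θ * v j) := by
    ext j; simp only [arcPoint, Real.cos_add, Real.sin_add]; ring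
  rw [e]
  exact eLpNorm_lorPow_rotation_le hm hr hp (Real.cos_sq_add_sin_sq δ) n1 n2 n3

lemma eLpNorm_lorPow_arc_steps_le {n k m : ℕ} {r p : ℝ} (hm : 1 ≤ m) (hr : 0 ≤ r) (hp : 1 ≤ p)
    {u v : Fin k → ℝ} (hu : ∑ j, u j ^ 2 = 1) (hv : ∑ j, v j ^ 2 = 1) (huv : ∑ j, u j * v j = 0)
    (δ : ℝ) (N : ℕ) :
    eLpNorm (fun g => lorPow r p (mulVec g (arcPoint u v (N * δ))) - lorPow r p (mulVec g u))
      ((2 * m : ℕ) : ℝ≥0∞) (gaussMatrix n k) ≤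
      N * (2 * (‖Real.cos δ - 1‖ₑ * radialMoment n r p m +
        ‖Real.sin δ‖ₑ * gradMoment n r p m)) := by
  have hm' : (1 : ℝ≥0∞) ≤ ((2 * m : ℕ) : ℝ≥0∞) := by exact_mod_cast (by omega : 1 ≤ 2 * m)
  have hp0 : 0 ≤ p := by linarith
  induction N with
  | zero =>
    have : arcPoint u v 0 = u := by ext j; simp [arcPoint]
    simp [this]
  | succ N ih =>
    have h := eLpNorm_lorPow_arc_step_le (n := n) hm hr hp hu hv huv (N * δ) δ
    rw [show N * δ + δ = ((N + 1 : ℕ) : ℝ) * δ by push_cast; ring] at h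
    have e : (fun g : Fin n → Fin k → ℝ => lorPow r p (mulVec g (arcPoint u v ((N + 1 : ℕ) * δ))) -
        lorPow r p (mulVec g u)) =
        (fun g => lorPow r p (mulVec g (arcPoint u v ((N + 1 : ℕ) * δ))) -
          lorPow r p (mulVec g (arcPoint u v (N * δ)))) +
        fun g => lorPow r p (mulVec g (arcPoint u v (N * δ))) - lorPow r p (mulVec g u) := by
      ext g; simp
    rw [e]
    refine (eLpNorm_add_le
      ((measurable_lorPow_mulVec hr hp0 _).sub (measurable_lorPow_mulVec hr hp0 _)).aestronglyMeasurable
      ((measurable_lorPow_mulVec hr hp0 _).sub (measurable_lorPow_mulVec hr hp0 _)).aestronglyMeasurable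
      hm').trans ((add_le_add h ih).trans (le_of_eq ?_))
    push_cast
    ring

lemma eLpNorm_lorPow_arc_le {n k m : ℕ} {r p : ℝ} (hm : 1 ≤ m) (hr : 0 ≤ r) (hp : 1 ≤ p)
    (hp2 : p ≤ 2) {u v : Fin k → ℝ} (hu : ∑ j, u j ^ 2 = 1) (hv : ∑ j, v j ^ 2 = 1)
    (huv : ∑ j, u j * v j = 0) {θ : ℝ} (hθ : 0 ≤ θ) :
    eLpNorm (fun g => lorPow r p (mulVec g (arcPoint u v θ)) - lorPow r p (mulVec g u))
      ((2 * m : ℕ) : ℝ≥0∞) (gaussMatrix n k) ≤ ENNReal.ofReal (2 * θ) * gradMoment n r p m := by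
  set Q := radialMoment n r p m with hQ
  set B := gradMoment n r p m with hB
  have hQt : Q ≠ ∞ := radialMoment_ne_top hr hp hp2 m
  have key : ∀ N : ℕ, eLpNorm (fun g => lorPow r p (mulVec g (arcPoint u v θ)) -
      lorPow r p (mulVec g u)) ((2 * m : ℕ) : ℝ≥0∞) (gaussMatrix n k) ≤
      ENNReal.ofReal (θ ^ 2 * (1 / ((N : ℝ) + 1))) * Q + ENNReal.ofReal (2 * θ) * B := by
    intro N
    have hN : (0 : ℝ) < (N : ℝ) + 1 := by positivity
    have h := eLpNorm_lorPow_arc_steps_le (n := n) hm hr hp hu hv huv (θ / (N + 1)) (N + 1)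
    rw [show ((N + 1 : ℕ) : ℝ) * (θ / (N + 1)) = θ by push_cast; field_simp] at h
    refine h.trans ?_
    set δ := θ / ((N : ℝ) + 1) with hδ
    have hδ0 : 0 ≤ δ := by positivity
    have h1 : ‖Real.cos δ - 1‖ₑ ≤ ENNReal.ofReal (δ ^ 2 / 2) := by
      rw [← ofReal_norm, Real.norm_eq_abs]
      apply ENNReal.ofReal_le_ofReal
      have := Real.one_sub_sq_div_two_le_cos (x := δ)
      rw [abs_le]; constructor <;> linarith [Real.cos_le_one δ, sq_nonneg δ]
    have h2 : ‖Real.sin δ‖ₑ ≤ ENNReal.ofReal δ := by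
      rw [← ofReal_norm, Real.norm_eq_abs]
      apply ENNReal.ofReal_le_ofReal
      exact Real.abs_sin_le_abs.trans_eq (abs_of_nonneg hδ0)
    have hc : ((N + 1 : ℕ) : ℝ≥0∞) * 2 = ENNReal.ofReal (2 * ((N : ℝ) + 1)) := by
      rw [ENNReal.ofReal_mul (by norm_num), mul_comm]
      congr 1
      · simp
      · rw [← ENNReal.ofReal_natCast]; push_cast; rfl
    calc _ ≤ ((N + 1 : ℕ) : ℝ≥0∞) * (2 * (ENNReal.ofReal (δ ^ 2 / 2) * Q + ENNReal.ofReal δ * B)) := by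
          gcongr
      _ = ENNReal.ofReal (2 * ((N : ℝ) + 1)) * ENNReal.ofReal (δ ^ 2 / 2) * Q +
          ENNReal.ofReal (2 * ((N : ℝ) + 1)) * ENNReal.ofReal δ * B := by rw [← hc]; ring
      _ = _ := by
          rw [← ENNReal.ofReal_mul (by positivity), ← ENNReal.ofReal_mul (by positivity)]
          congr 3
          · rw [hδ]; field_simp
          · rw [hδ]; field_simp
  have h0 : Filter.Tendsto (fun N : ℕ => ENNReal.ofReal (θ ^ 2 * (1 / ((N : ℝ) + 1))) * Q +
      ENNReal.ofReal (2 * θ) * B) Filter.atTop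
      (nhds (ENNReal.ofReal (θ ^ 2 * 0) * Q + ENNReal.ofReal (2 * θ) * B)) := by
    refine Filter.Tendsto.add ?_ tendsto_const_nhds
    refine ENNReal.Tendsto.mul_const ?_ (Or.inr hQt)
    exact ENNReal.tendsto_ofReal (tendsto_one_div_add_atTop_nhds_zero_nat.const_mul _)
  refine (ge_of_tendsto' h0 key).trans (le_of_eq ?_)
  simp

lemma lorPow_mulVec_neg {n k : ℕ} {r p : ℝ} (hp : 0 < p) (g : Fin n → Fin k → ℝ) (u : Fin k → ℝ) :
    lorPow r p (mulVec g fun j => -u j) = lorPow r p (mulVec g u) := by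
  have h := lorPow_mul (r := r) hp (-1) (mulVec g u)
  have e : (mulVec g fun j => -u j) = fun i => -1 * mulVec g u i := by
    ext i; simp [mulVec]
  rw [e, h]; simp

/-- Moments of the increments of the process `x ↦ lorPow (G x)` on the sphere. -/
lemma eLpNorm_lorPow_increment_le {n k m : ℕ} {r p : ℝ} (hm : 1 ≤ m) (hr : 0 ≤ r) (hp : 1 ≤ p)
    (hp2 : p ≤ 2) {u v : Fin k → ℝ} (hu : ∑ j, u j ^ 2 = 1) (hv : ∑ j, v j ^ 2 = 1) :
    eLpNorm (fun g => lorPow r p (mulVec g v) - lorPow r p (mulVec g u))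
      ((2 * m : ℕ) : ℝ≥0∞) (gaussMatrix n k) ≤
      ENNReal.ofReal (Real.pi * Real.sqrt (∑ j, (v j - u j) ^ 2)) * gradMoment n r p m := by
  set c := ∑ j, u j * v j with hc
  have hvu : ∀ a : ℝ, ∑ j, (v j - a * u j) ^ 2 = 1 - 2 * a * c + a ^ 2 := fun a => by
    have : ∀ j, (v j - a * u j) ^ 2 = v j ^ 2 + -(2 * a) * (u j * v j) + a ^ 2 * u j ^ 2 :=
      fun j => by ring
    simp only [this, Finset.sum_add_distrib, ← Finset.mul_sum, hu, hv, ← hc]; ring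
  have hpos : ∀ a : ℝ, 0 ≤ ∑ j, (v j - a * u j) ^ 2 := fun a =>
    Finset.sum_nonneg fun _ _ => sq_nonneg _
  have hcc := hpos c
  rw [hvu] at hcc
  have c1 : c ≤ 1 := by nlinarith
  have c2 : -1 ≤ c := by nlinarith
  have hd : ∑ j, (v j - u j) ^ 2 = 2 - 2 * c := by
    have := hvu 1
    simp only [one_mul] at this
    rw [this]; ring
  rcases (show 0 ≤ 1 - c ^ 2 by linarith).eq_or_lt with h0 | h0
  · have hz : ∀ j, v j = c * u j := by
      have : ∑ j, (v j - c * u j) ^ 2 = 0 := by rw [hvu]; linarith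
      intro j
      have := (Finset.sum_eq_zero_iff_of_nonneg fun _ _ => sq_nonneg _).1 this j (Finset.mem_univ j)
      nlinarith [pow_eq_zero_iff (two_ne_zero) |>.1 this]
    have hf : ∀ g : Fin n → Fin k → ℝ, lorPow r p (mulVec g v) = lorPow r p (mulVec g u) := by
      intro g
      have hc2 : (c - 1) * (c + 1) = 0 := by linarith
      rcases mul_eq_zero.1 hc2 with h | h
      · rw [show v = u from funext fun j => by rw [hz j, show c = 1 by linarith, one_mul]]
      · rw [show v = fun j => -u j from funext fun j => by rw [hz j, show c = -1 by linarith]; ring]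
        exact lorPow_mulVec_neg (by linarith) g u
    simp [hf]
  · set s := Real.sqrt (1 - c ^ 2) with hs
    have hs0 : 0 < s := Real.sqrt_pos.2 h0
    have hs2 : s ^ 2 = 1 - c ^ 2 := Real.sq_sqrt h0.le
    set w : Fin k → ℝ := fun j => (v j - c * u j) / s with hw
    have w1 : ∑ j, w j ^ 2 = 1 := by
      simp only [hw, div_pow]
      rw [← Finset.sum_div, hvu, div_eq_one_iff_eq (by positivity)]; rw [hs2]; ring
    have w2 : ∑ j, u j * w j = 0 := by
      have : ∀ j, u j * w j = (u j * v j - c * u j ^ 2) / s := fun j => by simp only [hw]; ring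
      simp only [this]
      rw [← Finset.sum_div, Finset.sum_sub_distrib, ← Finset.mul_sum, hu, ← hc]; simp
    have harc : arcPoint u w (Real.arccos c) = v := by
      ext j
      simp only [arcPoint, Real.cos_arccos c2 c1, Real.sin_arccos, ← hs, hw]
      field_simp
      ring
    have h := eLpNorm_lorPow_arc_le (n := n) hm hr hp hp2 hu w1 w2 (Real.arccos_nonneg c)
    rw [harc] at h
    refine h.trans (mul_le_mul_left (ENNReal.ofReal_le_ofReal ?_) _)
    set α := Real.arccos c with hα
    have ha0 : 0 ≤ α := Real.arccos_nonneg c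
    have ha1 : α ≤ Real.pi := Real.arccos_le_pi c
    have h2 : Real.sqrt (∑ j, (v j - u j) ^ 2) = 2 * Real.sin (α / 2) := by
      rw [hd, ← Real.cos_arccos c2 c1, ← hα, show α = 2 * (α / 2) by ring, Real.cos_two_mul']
      have h3 := Real.sin_nonneg_of_nonneg_of_le_pi (x := α / 2) (by linarith) (by linarith)
      rw [show 2 - 2 * (Real.cos (α / 2) ^ 2 - Real.sin (α / 2) ^ 2) = (2 * Real.sin (α / 2)) ^ 2 by
        have := Real.cos_sq_add_sin_sq (α / 2)
        linear_combination -2 * this, Real.sqrt_sq (by linarith)]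
      congr 2; ring
    rw [h2]
    have h3 := Real.mul_le_sin (x := α / 2) (by linarith) (by linarith)
    have hpi := Real.pi_pos
    calc 2 * α = Real.pi * (2 * (2 / Real.pi * (α / 2))) := by field_simp
      _ ≤ _ := by gcongr

/-- Moments of the difference between two independent copies of `lorPow`. -/
lemma eLpNorm_lorPow_prod_le {n m : ℕ} {r p : ℝ} (hm : 1 ≤ m) (hr : 0 ≤ r) (hp : 1 ≤ p)
    (hp2 : p ≤ 2) :
    eLpNorm (fun z : (Fin n → ℝ) × (Fin n → ℝ) => lorPow r p z.2 - lorPow r p z.1)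
      ((2 * m : ℕ) : ℝ≥0∞) ((_root_.stdGaussian n).prod (_root_.stdGaussian n)) ≤
      ENNReal.ofReal Real.pi * gradMoment n r p m := by
  have hu : ∑ j : Fin 2, (![1, 0] : Fin 2 → ℝ) j ^ 2 = 1 := by simp
  have hv : ∑ j : Fin 2, (![0, 1] : Fin 2 → ℝ) j ^ 2 = 1 := by simp
  have huv : ∑ j : Fin 2, (![1, 0] : Fin 2 → ℝ) j * (![0, 1] : Fin 2 → ℝ) j = 0 := by simp
  have h := eLpNorm_lorPow_arc_le (n := n) hm hr hp hp2 hu hv huv (θ := Real.pi / 2) (by positivity)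
  have e : arcPoint ![1, 0] ![0, 1] (Real.pi / 2) = (![0, 1] : Fin 2 → ℝ) := by
    ext j; fin_cases j <;> simp [arcPoint]
  have hf := (continuous_lorPow (n := n) (r := r) (p := p) hr (by linarith)).measurable
  rw [e, show 2 * (Real.pi / 2) = Real.pi by ring] at h
  have hm2 : Measurable fun z : (Fin n → ℝ) × (Fin n → ℝ) => lorPow r p z.2 - lorPow r p z.1 :=
    (hf.comp measurable_snd).sub (hf.comp measurable_fst)
  rw [← map_gaussMatrix_mulVec_pair hu hv huv, eLpNorm_map_measure hm2.aestronglyMeasurable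
    ((measurable_mulVec_left _).prodMk (measurable_mulVec_left _)).aemeasurable]
  exact h

lemma card_le_of_separated_sphere {k : ℕ} {δ : ℝ} (hδ : 0 < δ) (s : Finset (EuclideanSpace ℝ (Fin k)))
    (hs : ∀ c ∈ s, ‖c‖ = 1) (h : ∀ c ∈ s, ∀ d ∈ s, c ≠ d → δ ≤ dist c d) :
    (s.card : ℝ) ≤ (1 + 2 / δ) ^ k := by
  let μ : Measure (EuclideanSpace ℝ (Fin k)) := volume
  have hδ2 : 0 < δ / 2 := by positivity
  have hρ : 0 < 1 + δ / 2 := by positivity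
  have hd : Set.Pairwise (s : Set (EuclideanSpace ℝ (Fin k)))
      (Function.onFun Disjoint fun c => Metric.ball c (δ / 2)) := by
    intro c hc d hd hcd
    exact Metric.ball_disjoint_ball (by linarith [h c hc d hd hcd])
  have hsub : (⋃ c ∈ s, Metric.ball c (δ / 2)) ⊆
      Metric.ball (0 : EuclideanSpace ℝ (Fin k)) (1 + δ / 2) := by
    refine Set.iUnion₂_subset fun x hx => Metric.ball_subset_ball' ?_
    rw [dist_zero_right, hs x hx, add_comm]
  have hI : (s.card : ℝ≥0∞) * ENNReal.ofReal ((δ / 2) ^ k) * μ (Metric.ball 0 1) ≤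
      ENNReal.ofReal ((1 + δ / 2) ^ k) * μ (Metric.ball 0 1) := by
    have h1 := measure_mono (μ := μ) hsub
    rw [measure_biUnion_finset hd fun c _ => measurableSet_ball] at h1
    simp only [μ.addHaar_ball_of_pos _ hδ2, μ.addHaar_ball_of_pos _ hρ, Finset.sum_const,
      nsmul_eq_mul, finrank_euclideanSpace, Fintype.card_fin] at h1
    rwa [mul_assoc]
  have hJ := (ENNReal.mul_le_mul_iff_left (Metric.measure_ball_pos _ _ zero_lt_one).ne'
    measure_ball_lt_top.ne).1 hI
  have hK := ENNReal.toReal_le_of_le_ofReal (by positivity) hJ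
  rw [ENNReal.toReal_mul, ENNReal.toReal_natCast, ENNReal.toReal_ofReal (by positivity),
    ← le_div_iff₀ (by positivity), ← div_pow] at hK
  rwa [show (1 + δ / 2) / (δ / 2) = 1 + 2 / δ by field_simp; ring] at hK

lemma exists_net_sphere {k : ℕ} {δ : ℝ} (hδ : 0 < δ) :
    ∃ S : Finset (EuclideanSpace ℝ (Fin k)), (∀ s ∈ S, ‖s‖ = 1) ∧
      (S.card : ℝ) ≤ (1 + 2 / δ) ^ k ∧ ∀ x : EuclideanSpace ℝ (Fin k), ‖x‖ = 1 →
        ∃ s ∈ S, dist x s ≤ δ := by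
  classical
  let C : Set ℕ := {N | ∃ S : Finset (EuclideanSpace ℝ (Fin k)), S.card = N ∧ (∀ s ∈ S, ‖s‖ = 1) ∧
    ∀ c ∈ S, ∀ d ∈ S, c ≠ d → δ ≤ dist c d}
  have hne : C.Nonempty := ⟨0, ∅, by simp⟩
  have hbdd : BddAbove C := by
    refine ⟨⌊(1 + 2 / δ) ^ k⌋₊, ?_⟩
    rintro _ ⟨S, rfl, h1, h2⟩
    exact Nat.le_floor (card_le_of_separated_sphere hδ S h1 h2)
  obtain ⟨S, hcard, h1, h2⟩ := Nat.sSup_mem hne hbdd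
  refine ⟨S, h1, card_le_of_separated_sphere hδ S h1 h2, fun x hx => ?_⟩
  by_contra! hfar
  have hxS : x ∉ S := fun h => by
    have := hfar x h
    rw [dist_self] at this
    linarith
  have hmem : S.card + 1 ∈ C := by
    refine ⟨insert x S, Finset.card_insert_of_notMem hxS, ?_, ?_⟩
    · intro s hs
      rcases Finset.mem_insert.1 hs with rfl | hs
      · exact hx
      · exact h1 s hs
    · intro c hc d hd hcd
      rcases Finset.mem_insert.1 hc with hcx | hcS <;> rcases Finset.mem_insert.1 hd with hdx | hdS
      · exact absurd (hcx.trans hdx.symm) hcd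
      · rw [hcx]; exact (hfar d hdS).le
      · rw [hdx, dist_comm]; exact (hfar c hcS).le
      · exact h2 c hcS d hdS hcd
  have := le_csSup hbdd hmem
  omega

lemma measure_ge_le_of_eLpNorm_le {Ω : Type*} [MeasurableSpace Ω] {μ : Measure Ω} {f : Ω → ℝ}
    {q : ℕ} (hq : q ≠ 0) (hf : Measurable f) {a t : ℝ} (ht : 0 < t)
    (h : eLpNorm f q μ ≤ ENNReal.ofReal a) :
    μ {ω | t ≤ |f ω|} ≤ ENNReal.ofReal ((a / t) ^ q) := by
  rcases le_or_gt 0 a with ha | ha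
  · have h1 := meas_ge_le_mul_pow_eLpNorm_enorm μ (p := q) (by exact_mod_cast hq)
      (ENNReal.natCast_ne_top q) hf.aestronglyMeasurable (ε := ENNReal.ofReal t) (by simpa using ht)
      (fun h => absurd h ENNReal.ofReal_ne_top)
    have e : {ω | ENNReal.ofReal t ≤ ‖f ω‖ₑ} = {ω | t ≤ |f ω|} := by
      ext ω
      simp only [Set.mem_ofPred_eq]
      rw [← ofReal_norm, ENNReal.ofReal_le_ofReal_iff (norm_nonneg _), Real.norm_eq_abs]
    rw [e] at h1
    refine h1.trans ?_
    rw [ENNReal.toReal_natCast, ENNReal.rpow_natCast, ENNReal.rpow_natCast, ← mul_pow,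
      ENNReal.ofReal_pow (by positivity), div_eq_inv_mul, ENNReal.ofReal_mul (by positivity),
      ENNReal.ofReal_inv_of_pos ht]
    gcongr
  · have h0 : eLpNorm f q μ = 0 := by
      rw [ENNReal.ofReal_of_nonpos ha.le] at h
      exact le_antisymm h zero_le
    rw [eLpNorm_eq_zero_iff hf.aestronglyMeasurable (by exact_mod_cast hq)] at h0
    have : μ {ω | t ≤ |f ω|} = 0 := by
      refine measure_mono_null ?_ h0
      intro ω hω hz
      simp only [Set.mem_ofPred_eq, Pi.zero_apply] at hω hz
      rw [hz, abs_zero] at hω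
      linarith
    rw [this]
    exact zero_le

/-- Chaining on the sphere: a continuous process with `L^q`-Lipschitz increments, where `q` is
large compared with the dimension, has bounded oscillation with high probability. -/
lemma exists_measure_le_of_increments {Ω : Type*} [MeasurableSpace Ω] {μ : Measure Ω} {k q : ℕ}
    (hk : 1 ≤ k) (hq : 5 * k ≤ q) (Z : EuclideanSpace ℝ (Fin k) → Ω → ℝ)
    (hmeas : ∀ x, Measurable (Z x)) (hcont : ∀ ω, Continuous fun x => Z x ω) {A τ : ℝ}
    (hA : 0 ≤ A) (hτ : 0 < τ)
    (hinc : ∀ x y, ‖x‖ = 1 → ‖y‖ = 1 →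
      eLpNorm (fun ω => Z y ω - Z x ω) q μ ≤ ENNReal.ofReal (A * dist x y))
    {x₀ : EuclideanSpace ℝ (Fin k)} (hx₀ : ‖x₀‖ = 1) :
    ∃ B : Set Ω, μ B ≤ ENNReal.ofReal (2 * (6 * A / τ) ^ q) ∧
      ∀ ω, ω ∉ B → ∀ x, ‖x‖ = 1 → |Z x ω - Z x₀ ω| ≤ 2 * τ := by
  have hnet : ∀ j : ℕ, ∃ S : Finset (EuclideanSpace ℝ (Fin k)), (∀ s ∈ S, ‖s‖ = 1) ∧
      (S.card : ℝ) ≤ (2 * 4 ^ j) ^ k ∧ (∀ x : EuclideanSpace ℝ (Fin k), ‖x‖ = 1 →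
        ∃ s ∈ S, dist x s ≤ 2 * (1 / 4) ^ j) ∧ (j = 0 → S = {x₀}) := by
    intro j
    rcases Nat.eq_zero_or_pos j with rfl | hj
    · refine ⟨{x₀}, by simpa using hx₀, by simpa using one_le_pow₀ (by norm_num), fun x hx =>
        ⟨x₀, by simp, ?_⟩, fun _ => rfl⟩
      rw [dist_eq_norm]
      have := norm_sub_le x x₀
      rw [hx, hx₀] at this
      simpa using (by linarith : ‖x - x₀‖ ≤ 2)
    · obtain ⟨S, h1, h2, h3⟩ := exists_net_sphere (k := k) (δ := 2 * (1 / 4) ^ j) (by positivity)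
      refine ⟨S, h1, h2.trans ?_, h3, fun h => by omega⟩
      gcongr
      have e : 2 / (2 * (1 / 4 : ℝ) ^ j) = 4 ^ j := by
        rw [one_div, inv_pow]; field_simp
      rw [e]
      linarith [one_le_pow₀ (by norm_num : (1 : ℝ) ≤ 4) (n := j)]
  choose S hS1 hS2 hS3 hS4 using hnet
  let B : Set Ω := ⋃ j : ℕ, ⋃ e ∈ (S j ×ˢ S (j + 1)).filter fun e => dist e.1 e.2 ≤ 3 * (1 / 4) ^ j,
    {ω | τ * (1 / 2) ^ j ≤ |Z e.2 ω - Z e.1 ω|}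
  have hq0 : q ≠ 0 := by omega
  refine ⟨B, ?_, ?_⟩
  · have hlevel : ∀ j : ℕ,
        μ (⋃ e ∈ (S j ×ˢ S (j + 1)).filter fun e => dist e.1 e.2 ≤ 3 * (1 / 4) ^ j,
          {ω | τ * (1 / 2) ^ j ≤ |Z e.2 ω - Z e.1 ω|}) ≤
        ENNReal.ofReal ((6 * A / τ) ^ q * (1 / 2) ^ j) := by
      intro j
      set T := (S j ×ˢ S (j + 1)).filter fun e => dist e.1 e.2 ≤ 3 * (1 / 4) ^ j
      have hT : (T.card : ℝ) ≤ 2 ^ (4 * k * (j + 1)) := by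
        have h1 : T.card ≤ (S j).card * (S (j + 1)).card :=
          (Finset.card_filter_le _ _).trans (Finset.card_product _ _).le
        calc (T.card : ℝ) ≤ (S j).card * (S (j + 1)).card := by exact_mod_cast h1
          _ ≤ (2 * 4 ^ j) ^ k * (2 * 4 ^ (j + 1)) ^ k := by gcongr <;> exact hS2 _
          _ = (16 ^ (j + 1)) ^ k := by
              rw [← mul_pow]; congr 1
              rw [show (16 : ℝ) = 4 * 4 by norm_num, mul_pow]; ring
          _ = _ := by
              rw [show (16 : ℝ) = 2 ^ 4 by norm_num, ← pow_mul, ← pow_mul]; congr 1; ring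
      calc _ ≤ ∑ e ∈ T, μ {ω | τ * (1 / 2) ^ j ≤ |Z e.2 ω - Z e.1 ω|} := measure_biUnion_finset_le _ _
        _ ≤ ∑ _e ∈ T, ENNReal.ofReal ((3 * A / τ * (1 / 2) ^ j) ^ q) := by
            refine Finset.sum_le_sum fun e he => ?_
            obtain ⟨he1, he2⟩ := Finset.mem_filter.1 he
            obtain ⟨ha, hb⟩ := Finset.mem_product.1 he1
            have h1 := (hinc e.1 e.2 (hS1 _ _ ha) (hS1 _ _ hb)).trans
              (ENNReal.ofReal_le_ofReal (mul_le_mul_of_nonneg_left he2 hA))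
            refine (measure_ge_le_of_eLpNorm_le hq0 ((hmeas e.2).sub (hmeas e.1))
              (t := τ * (1 / 2) ^ j) (by positivity) h1).trans (le_of_eq ?_)
            congr 2
            rw [show (1 / 4 : ℝ) = 1 / 2 * (1 / 2) by norm_num, mul_pow]
            field_simp
        _ = ENNReal.ofReal (T.card * (3 * A / τ * (1 / 2) ^ j) ^ q) := by
            rw [Finset.sum_const, nsmul_eq_mul, ENNReal.ofReal_mul (by positivity),
              ENNReal.ofReal_natCast]
        _ ≤ _ := by
            apply ENNReal.ofReal_le_ofReal
            have h2 : (T.card : ℝ) * (1 / 2) ^ (j * q) ≤ 2 ^ q * (1 / 2) ^ j := by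
              have h3 : (2 : ℝ) ^ (4 * k * (j + 1)) * 2 ^ j ≤ 2 ^ q * 2 ^ (j * q) := by
                rw [← pow_add, ← pow_add]
                apply pow_le_pow_right₀ (by norm_num)
                nlinarith
              rw [one_div, inv_pow, inv_pow, ← div_eq_mul_inv, ← div_eq_mul_inv,
                div_le_div_iff₀ (by positivity) (by positivity)]
              exact (mul_le_mul_of_nonneg_right hT (by positivity)).trans h3
            calc (T.card : ℝ) * (3 * A / τ * (1 / 2) ^ j) ^ q
                = (3 * A / τ) ^ q * (T.card * (1 / 2) ^ (j * q)) := by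
                  rw [mul_pow, ← pow_mul]; ring
              _ ≤ (3 * A / τ) ^ q * (2 ^ q * (1 / 2) ^ j) := by gcongr
              _ = _ := by rw [← mul_assoc, ← mul_pow]; congr 2; ring
    refine (measure_iUnion_le _).trans ((ENNReal.tsum_le_tsum hlevel).trans (le_of_eq ?_))
    rw [← ENNReal.ofReal_tsum_of_nonneg (fun j => by positivity)
      (summable_geometric_two.mul_left _), tsum_mul_left, tsum_geometric_two, mul_comm]
  · intro ω hω x hx
    choose s hs1 hs2 using fun j => hS3 j x hx
    have hs0 : s 0 = x₀ := by
      have := hs1 0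
      rw [hS4 0 rfl] at this
      simpa using this
    have hstep : ∀ j, |Z (s (j + 1)) ω - Z (s j) ω| < τ * (1 / 2) ^ j := by
      intro j
      by_contra! hj
      apply hω
      refine Set.mem_iUnion.2 ⟨j, Set.mem_iUnion₂.2 ⟨(s j, s (j + 1)), ?_, hj⟩⟩
      refine Finset.mem_filter.2 ⟨Finset.mem_product.2 ⟨hs1 j, hs1 (j + 1)⟩, ?_⟩
      have h1 := dist_triangle (s j) x (s (j + 1))
      rw [dist_comm (s j) x] at h1
      have h2 := hs2 j
      have h3 := hs2 (j + 1)
      rw [pow_succ] at h3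
      have : (0 : ℝ) < (1 / 4) ^ j := by positivity
      simp only
      linarith
    have hsum : ∀ N, |Z (s N) ω - Z x₀ ω| ≤ 2 * τ - 2 * τ * (1 / 2) ^ N := by
      intro N
      induction N with
      | zero => simp [hs0]
      | succ N ih =>
        have h1 := abs_sub_le (Z (s (N + 1)) ω) (Z (s N) ω) (Z x₀ ω)
        have h2 := hstep N
        rw [pow_succ]
        linarith
    have hlim : Filter.Tendsto s Filter.atTop (nhds x) := by
      rw [tendsto_iff_dist_tendsto_zero]
      have h0 : Filter.Tendsto (fun j : ℕ => 2 * (1 / 4 : ℝ) ^ j) Filter.atTop (nhds 0) := by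
        simpa using (tendsto_pow_atTop_nhds_zero_of_lt_one (r := (1 / 4 : ℝ)) (by norm_num)
          (by norm_num)).const_mul 2
      exact squeeze_zero (fun _ => dist_nonneg) (fun j => (dist_comm _ _).trans_le (hs2 j)) h0
    have hlim2 := (((hcont ω).tendsto x).comp hlim).sub_const (Z x₀ ω) |>.abs
    refine le_of_tendsto' hlim2 fun N => (hsum N).trans ?_
    have : (0 : ℝ) < (1 / 2) ^ N := by positivity
    nlinarith

lemma measure_le_two_mul_prod {α : Type*} [MeasurableSpace α] {ν : Measure α}
    [SFinite ν] {s t : Set α} (ht : 1 / 2 ≤ ν t) {D : Set (α × α)} (h : s ×ˢ t ⊆ D) :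
    ν s ≤ 2 * (ν.prod ν) D := by
  have h1 := measure_mono (μ := ν.prod ν) h
  rw [Measure.prod_prod] at h1
  calc ν s = 2 * (ν s * (1 / 2)) := by
        rw [mul_comm (ν s), ← mul_assoc, one_div, ENNReal.mul_inv_cancel (by simp) (by simp), one_mul]
    _ ≤ 2 * (ν s * ν t) := by gcongr
    _ ≤ _ := by gcongr

lemma measure_abs_sub_median_ge_le {α : Type*} [MeasurableSpace α] {ν : Measure α}
    [SFinite ν] {f : α → ℝ} {a τ : ℝ} (h1 : 1 / 2 ≤ ν {x | a ≤ f x})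
    (h2 : 1 / 2 ≤ ν {x | f x ≤ a}) :
    ν {x | τ ≤ |f x - a|} ≤ 4 * (ν.prod ν) {z | τ ≤ |f z.2 - f z.1|} := by
  have e1 : ν {x | τ ≤ f x - a} ≤ 2 * (ν.prod ν) {z | τ ≤ |f z.2 - f z.1|} := by
    refine measure_le_two_mul_prod h2 ?_
    rintro ⟨x, y⟩ ⟨hx, hy⟩
    simp only [Set.mem_ofPred_eq] at hx hy ⊢
    rw [abs_sub_comm]
    exact le_trans (by linarith) (le_abs_self _)
  have e2 : ν {x | τ ≤ a - f x} ≤ 2 * (ν.prod ν) {z | τ ≤ |f z.2 - f z.1|} := by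
    refine measure_le_two_mul_prod h1 ?_
    rintro ⟨x, y⟩ ⟨hx, hy⟩
    simp only [Set.mem_ofPred_eq] at hx hy ⊢
    exact le_trans (by linarith) (le_abs_self _)
  calc ν {x | τ ≤ |f x - a|} ≤ ν ({x | τ ≤ f x - a} ∪ {x | τ ≤ a - f x}) := by
        refine measure_mono fun x hx => ?_
        simp only [Set.mem_ofPred_eq, Set.mem_union] at hx ⊢
        rcases le_abs.1 hx with h | h
        · exact Or.inl h
        · exact Or.inr (by linarith)
    _ ≤ _ := measure_union_le _ _
    _ ≤ _ := add_le_add e1 e2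
    _ = _ := by rw [← add_mul]; norm_num

lemma gaussianReal_Icc_le (a : ℝ) :
    gaussianReal 0 1 (Set.Icc (-a) a) ≤ ENNReal.ofReal a := by
  rw [gaussianReal_apply 0 (by simp)]
  calc _ ≤ ∫⁻ _x in Set.Icc (-a) a, ENNReal.ofReal (1 / 2) := by
        refine lintegral_mono fun x => ENNReal.ofReal_le_ofReal ?_
        rw [gaussianPDFReal]
        have h1 : Real.exp (-(x - 0) ^ 2 / (2 * ((1 : NNReal) : ℝ))) ≤ 1 := by
          rw [Real.exp_le_one_iff]
          have := sq_nonneg x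
          simp only [sub_zero, NNReal.coe_one]
          linarith
        have h2 : (√(2 * Real.pi * ((1 : NNReal) : ℝ)))⁻¹ ≤ 1 / 2 := by
          rw [one_div]
          refine inv_anti₀ (by norm_num) (Real.le_sqrt_of_sq_le ?_)
          simp only [NNReal.coe_one]
          linarith [Real.pi_gt_three]
        calc _ ≤ (1 / 2 : ℝ) * 1 := by gcongr
          _ = _ := mul_one _
    _ = _ := by
        rw [lintegral_const, Measure.restrict_apply_univ, Real.volume_Icc,
          ← ENNReal.ofReal_mul (by norm_num)]
        congr 1; ring

lemma measure_card_small_le {n : ℕ} (hn : 0 < n) :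
    _root_.stdGaussian n {x | (n : ℝ) / 2 ≤
      ((Finset.univ.filter fun i : Fin n => |x i| ≤ 1 / 8).card : ℝ)} ≤ 1 / 4 := by
  set S : Fin n → Set (Fin n → ℝ) := fun i => {x | |x i| ≤ 1 / 8} with hS
  have hSm : ∀ i, MeasurableSet (S i) := fun i =>
    measurableSet_le (measurable_pi_apply i).abs measurable_const
  have hSi : ∀ i, _root_.stdGaussian n (S i) ≤ ENNReal.ofReal (1 / 8) := by
    intro i
    have e : S i = (fun x : Fin n → ℝ => x i) ⁻¹' (Set.Icc (-(1 / 8)) (1 / 8)) := by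
      ext x; simp [hS, abs_le]
    have h := (measurePreserving_eval (fun _ : Fin n => gaussianReal 0 1) i).measure_preimage
      (measurableSet_Icc (a := (-(1 / 8) : ℝ)) (b := 1 / 8)).nullMeasurableSet
    rw [e]
    exact (le_of_eq h).trans (gaussianReal_Icc_le _)
  have hcount : ∀ x : Fin n → ℝ, ((Finset.univ.filter fun i : Fin n => |x i| ≤ 1 / 8).card : ℝ≥0∞) =
      ∑ i, (S i).indicator 1 x := by
    intro x
    rw [Finset.card_filter]
    push_cast
    exact Finset.sum_congr rfl fun i _ => by simp [hS, Set.indicator]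
  have hintegral : ∫⁻ x, ∑ i, (S i).indicator 1 x ∂_root_.stdGaussian n ≤ ENNReal.ofReal (n / 8) := by
    rw [lintegral_finsetSum _ fun i _ => measurable_one.indicator (hSm i)]
    simp only [lintegral_indicator_one (hSm _)]
    refine (Finset.sum_le_sum fun i _ => hSi i).trans (le_of_eq ?_)
    rw [Finset.sum_const, Finset.card_univ, Fintype.card_fin, nsmul_eq_mul,
      ← ENNReal.ofReal_natCast, ← ENNReal.ofReal_mul (by positivity)]
    congr 1; ring
  have hmk := mul_meas_ge_le_lintegral (μ := _root_.stdGaussian n)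
    (Finset.measurable_sum Finset.univ fun i _ => (measurable_one (α := ℝ≥0∞)).indicator (hSm i))
    (ENNReal.ofReal (n / 2))
  have hset : {x : Fin n → ℝ | (n : ℝ) / 2 ≤
      ((Finset.univ.filter fun i : Fin n => |x i| ≤ 1 / 8).card : ℝ)} ⊆
      {x | ENNReal.ofReal (n / 2) ≤ ∑ i, (S i).indicator 1 x} := by
    intro x hx
    simp only [Set.mem_ofPred_eq] at hx ⊢
    rw [← hcount, ← ENNReal.ofReal_natCast]
    exact ENNReal.ofReal_le_ofReal hx
  have hn0 : (0 : ℝ) < n := by exact_mod_cast hn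
  have h0 : ENNReal.ofReal (n / 2 : ℝ) ≠ 0 := by simpa using hn
  have hfin := (mul_le_mul_right (measure_mono (μ := _root_.stdGaussian n) hset)
    (ENNReal.ofReal (n / 2))).trans (hmk.trans hintegral)
  have e : ENNReal.ofReal (n / 8 : ℝ) = ENNReal.ofReal (n / 2) * (1 / 4) := by
    rw [show (1 / 4 : ℝ≥0∞) = ENNReal.ofReal (1 / 4) by
      rw [ENNReal.ofReal_div_of_pos (by norm_num)]; simp, ← ENNReal.ofReal_mul (by positivity)]
    congr 1; ring
  rw [e] at hfin
  exact (ENNReal.mul_le_mul_iff_right h0 ENNReal.ofReal_ne_top).1 hfin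

lemma le_lorPow_of_card_small {n : ℕ} {r p : ℝ} (hr : 0 ≤ r) (hp : 0 ≤ p) (hp2 : p ≤ 2)
    (hrp : p = 2 - 2 * r) (x : Fin n → ℝ)
    (hx : ((Finset.univ.filter fun i : Fin n => |x i| ≤ 1 / 8).card : ℝ) < n / 2) :
    (n : ℝ) ^ (p / 2) / 128 ≤ lorPow r p x := by
  have hn : (0 : ℝ) < n := by
    have : (0 : ℝ) ≤ ((Finset.univ.filter fun i : Fin n => |x i| ≤ 1 / 8).card : ℝ) := by positivity
    linarith
  have hcard : (n : ℝ) / 2 ≤ ((Finset.univ.filter fun i : Fin n => ¬ |x i| ≤ 1 / 8).card : ℝ) := by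
    have := Finset.card_filter_add_card_filter_not (s := (Finset.univ : Finset (Fin n)))
      (fun i => |x i| ≤ 1 / 8)
    rw [Finset.card_univ, Fintype.card_fin] at this
    have h2 : ((Finset.univ.filter fun i : Fin n => |x i| ≤ 1 / 8).card : ℝ) +
        ((Finset.univ.filter fun i : Fin n => ¬ |x i| ≤ 1 / 8).card : ℝ) = n := by
      exact_mod_cast this
    linarith
  have e : (n : ℝ) ^ (p / 2) = n * (n : ℝ) ^ (-r) := by
    rw [show p / 2 = 1 + -r by rw [hrp]; ring, Real.rpow_add hn, Real.rpow_one]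
  rw [lorPow_eq, e]
  calc n * (n : ℝ) ^ (-r) / 128 = n / 2 * ((n : ℝ) ^ (-r) * (1 / 64)) := by ring
    _ ≤ ((Finset.univ.filter fun i : Fin n => ¬ |x i| ≤ 1 / 8).card : ℝ) *
        ((n : ℝ) ^ (-r) * (1 / 64)) := by gcongr
    _ = ∑ i ∈ Finset.univ.filter fun i : Fin n => ¬ |x i| ≤ 1 / 8, (n : ℝ) ^ (-r) * (1 / 64) := by
        rw [Finset.sum_const, nsmul_eq_mul]
    _ ≤ ∑ l ∈ Finset.univ.filter fun i : Fin n => ¬ |x i| ≤ 1 / 8,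
        (((decPerm x).symm l : ℕ) + 1 : ℝ) ^ (-r) * |x l| ^ p := by
        refine Finset.sum_le_sum fun l hl => ?_
        have hl' : 1 / 8 ≤ |x l| := by
          have := (Finset.mem_filter.1 hl).2
          linarith
        have h1 : (n : ℝ) ^ (-r) ≤ (((decPerm x).symm l : ℕ) + 1 : ℝ) ^ (-r) :=
          Real.rpow_le_rpow_of_nonpos (by positivity)
            (by exact_mod_cast ((decPerm x).symm l).isLt) (by linarith)
        have h2 : (1 / 64 : ℝ) ≤ |x l| ^ p :=
          calc (1 / 64 : ℝ) = (1 / 8 : ℝ) ^ (2 : ℝ) := by rw [Real.rpow_two]; norm_num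
            _ ≤ (1 / 8 : ℝ) ^ p :=
              Real.rpow_le_rpow_of_exponent_ge (by norm_num) (by norm_num) hp2
            _ ≤ _ := Real.rpow_le_rpow (by norm_num) hl' hp
        gcongr
    _ ≤ _ := Finset.sum_le_univ_sum_of_nonneg fun l => by positivity

lemma lorNorm_rpow {n : ℕ} {r p : ℝ} (hp : 0 < p) (x : Fin n → ℝ) :
    lorNorm r p x ^ p = lorPow r p x := by
  rw [lorNorm_eq, ← Real.rpow_mul (lorPow_nonneg r p x), one_div, inv_mul_cancel₀ hp.ne',
    Real.rpow_one]

lemma lorNorm_nonneg {n : ℕ} (r p : ℝ) (x : Fin n → ℝ) : 0 ≤ lorNorm r p x :=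
  Real.rpow_nonneg (lorPow_nonneg r p x) _

/-- A median of the Lorentz norm is at least of order `n ^ (1 / 2)`. -/
lemma IsMedian.lorNorm_lower {n : ℕ} (hn : 0 < n) {r p M : ℝ} (hr : 0 ≤ r) (hp : 0 < p)
    (hp2 : p ≤ 2) (hrp : p = 2 - 2 * r)
    (hM : IsMedian (_root_.stdGaussian n) (lorNorm r p) M) :
    0 < M ∧ (n : ℝ) ^ (p / 2) / 128 ≤ M ^ p := by
  have hn0 : (0 : ℝ) < n := by exact_mod_cast hn
  have hM0 : 0 ≤ M := by
    have hne : {x : Fin n → ℝ | lorNorm r p x ≤ M}.Nonempty := by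
      rw [Set.nonempty_iff_ne_empty]
      intro h
      have := hM.2
      rw [h] at this
      simp at this
    obtain ⟨x, hx⟩ := hne
    exact (lorNorm_nonneg r p x).trans hx
  have hb : (n : ℝ) ^ (p / 2) / 128 ≤ M ^ p := by
    by_contra! hlt
    have hsub : {x : Fin n → ℝ | lorNorm r p x ≤ M} ⊆ {x | (n : ℝ) / 2 ≤
        ((Finset.univ.filter fun i : Fin n => |x i| ≤ 1 / 8).card : ℝ)} := by
      intro x hx
      simp only [Set.mem_ofPred_eq] at hx ⊢
      by_contra! hc
      have h1 := le_lorPow_of_card_small hr hp.le hp2 hrp x hc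
      have h2 := Real.rpow_le_rpow (lorNorm_nonneg r p x) hx hp.le
      rw [lorNorm_rpow hp] at h2
      linarith
    have h3 := hM.2.trans ((measure_mono hsub).trans (measure_card_small_le hn))
    rw [one_div, one_div, ENNReal.inv_le_inv] at h3
    norm_num at h3
  refine ⟨?_, hb⟩
  rcases hM0.eq_or_lt with h | h
  · rw [← h, Real.zero_rpow hp.ne'] at hb
    have : 0 < (n : ℝ) ^ (p / 2) / 128 := by positivity
    linarith
  · exact h

lemma mul_gradBound_le {n m : ℕ} {c ε p Λ : ℝ} (hn : 3 ≤ n) (hc : 0 < c) (hc1 : c ≤ 1)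
    (hε : 0 < ε) (hp : 1 ≤ p) (hp2 : p ≤ 2) (hΛ : 0 ≤ Λ) (hm : (m : ℝ) ≤ 4 * Λ)
    (hE : Λ ≤ c * n * (1 + (p - 1) * Real.log n) * ε ^ 2 / Real.log n)
    (hF : Λ ≤ c * n * ε ^ (2 / p) / Real.log n ^ ((2 - p) / p)) :
    m * gradBound n (p - 1) m ≤ 32 * c * (n : ℝ) ^ p * ε ^ 2 := by
  have hn0 : (0 : ℝ) < n := by positivity
  have hp0 : 0 < p := by linarith
  set L := Real.log n with hL
  have hL0 : 0 < L := Real.log_pos (by exact_mod_cast (by omega : 1 < n))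
  have ht : 0 < 1 + (p - 1) * L := by nlinarith
  have hm0 : (0 : ℝ) ≤ m := by positivity
  have h1 : m * ((n : ℝ) ^ (p - 1) * (4 * L / (1 + (p - 1) * L))) ≤
      16 * c * (n : ℝ) ^ p * ε ^ 2 :=
    calc m * ((n : ℝ) ^ (p - 1) * (4 * L / (1 + (p - 1) * L)))
        ≤ 4 * (c * n * (1 + (p - 1) * L) * ε ^ 2 / L) *
            ((n : ℝ) ^ (p - 1) * (4 * L / (1 + (p - 1) * L))) := by
          gcongr; linarith
      _ = 16 * c * ((n : ℝ) ^ (p - 1) * n) * ε ^ 2 := by field_simp; ring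
      _ = _ := by
          rw [← Real.rpow_add_one hn0.ne', sub_add_cancel]
  have hΛp : Λ ^ p * L ^ (2 - p) ≤ c * (n : ℝ) ^ p * ε ^ 2 := by
    have h := Real.rpow_le_rpow hΛ hF hp0.le
    rw [Real.div_rpow (by positivity) (by positivity), Real.mul_rpow (by positivity) (by positivity),
      Real.mul_rpow hc.le hn0.le, ← Real.rpow_mul hε.le, ← Real.rpow_mul hL0.le,
      div_mul_cancel₀ _ hp0.ne', div_mul_cancel₀ _ hp0.ne', le_div_iff₀ (by positivity),
      Real.rpow_two] at h
    refine h.trans ?_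
    gcongr
    calc c ^ p ≤ c ^ (1 : ℝ) := Real.rpow_le_rpow_of_exponent_ge hc hc1 hp
      _ = c := Real.rpow_one c
  have h2 : m * ((m : ℝ) ^ (p - 1) * (2 * L) ^ (1 - (p - 1))) ≤ 16 * c * (n : ℝ) ^ p * ε ^ 2 :=
    calc m * ((m : ℝ) ^ (p - 1) * (2 * L) ^ (1 - (p - 1)))
        = (m : ℝ) ^ p * (2 * L) ^ (2 - p) := by
          rw [← mul_assoc, show (1 : ℝ) - (p - 1) = 2 - p by ring,
            show (m : ℝ) ^ p = m ^ (1 + (p - 1)) by ring_nf,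
            Real.rpow_one_add' hm0 (by linarith)]
      _ ≤ (4 * Λ) ^ p * (2 * L) ^ (2 - p) := by gcongr
      _ = 4 ^ p * 2 ^ (2 - p) * (Λ ^ p * L ^ (2 - p)) := by
          rw [Real.mul_rpow (by norm_num) hΛ, Real.mul_rpow (by norm_num) hL0.le]; ring
      _ ≤ 4 ^ (p : ℝ) * 4 ^ (2 - p) * (c * (n : ℝ) ^ p * ε ^ 2) := by
          gcongr; norm_num
      _ = _ := by
          rw [← Real.rpow_add (by norm_num), add_sub_cancel, Real.rpow_two]; ring
  rw [gradBound, mul_add]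
  linarith

lemma eucNorm_eq_norm {k : ℕ} (x : Fin k → ℝ) : eucNorm x = ‖WithLp.toLp 2 x‖ := by
  simp [eucNorm, EuclideanSpace.norm_eq]

lemma continuous_mulVec_right {n k : ℕ} (g : Fin n → Fin k → ℝ) :
    Continuous (mulVec g) := by
  unfold mulVec; fun_prop

lemma lorNorm_smul {n : ℕ} {r p : ℝ} (hp : 0 < p) {c : ℝ} (hc : 0 ≤ c) (x : Fin n → ℝ) :
    lorNorm r p (fun i => c * x i) = c * lorNorm r p x := by
  rw [lorNorm_eq, lorNorm_eq, lorPow_mul hp, Real.mul_rpow (by positivity) (lorPow_nonneg r p x),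
    abs_of_nonneg hc, ← Real.rpow_mul hc, mul_one_div_cancel hp.ne', Real.rpow_one]

/-- An estimate of `lorNorm (g x)` on the unit sphere extends to the whole space. -/
lemma lorNorm_mulVec_bounds {n k : ℕ} {r p a b : ℝ} (hp : 0 < p) {g : Fin n → Fin k → ℝ}
    (h : ∀ u : EuclideanSpace ℝ (Fin k), ‖u‖ = 1 →
      a ≤ lorNorm r p (mulVec g u) ∧ lorNorm r p (mulVec g u) ≤ b) (x : Fin k → ℝ) :
    a * eucNorm x ≤ lorNorm r p (mulVec g x) ∧ lorNorm r p (mulVec g x) ≤ b * eucNorm x := by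
  set y : EuclideanSpace ℝ (Fin k) := WithLp.toLp 2 x with hy
  rw [eucNorm_eq_norm, ← hy]
  rcases eq_or_ne y 0 with h0 | h0
  · have hx : x = 0 := by simpa [hy] using h0
    have e : mulVec g x = fun i => 0 * mulVec g x i := by
      ext i; simp [hx, mulVec]
    rw [e, lorNorm_smul hp le_rfl, h0]
    simp
  · have hy0 : 0 < ‖y‖ := norm_pos_iff.2 h0
    obtain ⟨h1, h2⟩ := h (‖y‖⁻¹ • y) (norm_smul_inv_norm (𝕜 := ℝ) h0)
    have e : mulVec g x = fun i => ‖y‖ * mulVec g (‖y‖⁻¹ • y : EuclideanSpace ℝ (Fin k)) i := by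
      ext i
      simp only [mulVec, Finset.mul_sum, PiLp.smul_apply, smul_eq_mul]
      refine Finset.sum_congr rfl fun j _ => ?_
      rw [mul_left_comm, ← mul_assoc ‖y‖, mul_inv_cancel₀ hy0.ne', one_mul]
    rw [e, lorNorm_smul hp hy0.le, mul_comm a, mul_comm b]
    exact ⟨by gcongr, by gcongr⟩

lemma lorNorm_bounds_of_lorPow {n : ℕ} {r p M ε : ℝ} (hp : 1 ≤ p) (hM : 0 < M) (hε : 0 < ε)
    (hε1 : ε < 1) {x : Fin n → ℝ} (h : |lorPow r p x - M ^ p| ≤ ε * M ^ p) :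
    (1 - ε) * M ≤ lorNorm r p x ∧ lorNorm r p x ≤ (1 + ε) * M := by
  have hp0 : 0 < p := by linarith
  have hMp : 0 < M ^ p := by positivity
  obtain ⟨h1, h2⟩ := abs_le.1 h
  rw [← lorNorm_rpow hp0] at h1 h2
  constructor
  · rw [← Real.rpow_le_rpow_iff (mul_nonneg (by linarith) hM.le) (lorNorm_nonneg r p x) hp0,
      Real.mul_rpow (by linarith) hM.le]
    have : (1 - ε) ^ p ≤ 1 - ε :=
      (Real.rpow_le_rpow_of_exponent_ge (by linarith) (by linarith) hp).trans_eq (Real.rpow_one _)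
    nlinarith
  · rw [← Real.rpow_le_rpow_iff (lorNorm_nonneg r p x) (by positivity) hp0,
      Real.mul_rpow (by linarith) hM.le]
    have : 1 + ε ≤ (1 + ε) ^ p :=
      (Real.rpow_one _).symm.trans_le (Real.rpow_le_rpow_of_exponent_le (by linarith) hp)
    nlinarith

/-- Deviation of `lorPow (G u)` from its median in terms of a moment bound. -/
lemma measure_lorPow_mulVec_sub_median_le {n k m : ℕ} {r p M τ b : ℝ} (hm : 1 ≤ m) (hr : 0 ≤ r)
    (hp : 1 ≤ p) (hp2 : p ≤ 2) (hM0 : 0 < M) (hτ : 0 < τ)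
    (hM : IsMedian (_root_.stdGaussian n) (lorNorm r p) M)
    (hb : gradMoment n r p m ≤ ENNReal.ofReal b) {u : Fin k → ℝ} (hu : ∑ j, u j ^ 2 = 1) :
    gaussMatrix n k {g | τ ≤ |lorPow r p (mulVec g u) - M ^ p|} ≤
      ENNReal.ofReal (4 * (Real.pi * b / τ) ^ (2 * m)) := by
  have hp0 : 0 < p := by linarith
  have hc := (continuous_lorPow (n := n) hr hp0.le).measurable
  have hmeas : MeasurableSet {x : Fin n → ℝ | τ ≤ |lorPow r p x - M ^ p|} :=
    measurableSet_le measurable_const (hc.sub_const _).abs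
  have e : {g : Fin n → Fin k → ℝ | τ ≤ |lorPow r p (mulVec g u) - M ^ p|} =
      (fun g => mulVec g u) ⁻¹' {x | τ ≤ |lorPow r p x - M ^ p|} := rfl
  rw [e, ← Measure.map_apply (measurable_mulVec_left u) hmeas, map_gaussMatrix_mulVec hu]
  have e1 : {x : Fin n → ℝ | M ≤ lorNorm r p x} = {x | M ^ p ≤ lorPow r p x} := by
    ext x
    simp only [Set.mem_ofPred_eq]
    rw [← lorNorm_rpow hp0, Real.rpow_le_rpow_iff hM0.le (lorNorm_nonneg r p x) hp0]
  have e2 : {x : Fin n → ℝ | lorNorm r p x ≤ M} = {x | lorPow r p x ≤ M ^ p} := by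
    ext x
    simp only [Set.mem_ofPred_eq]
    rw [← lorNorm_rpow hp0, Real.rpow_le_rpow_iff (lorNorm_nonneg r p x) hM0.le hp0]
  have h1 := hM.1
  have h2 := hM.2
  rw [e1] at h1
  rw [e2] at h2
  refine (measure_abs_sub_median_ge_le (τ := τ) h1 h2).trans ?_
  have h3 : eLpNorm (fun z : (Fin n → ℝ) × (Fin n → ℝ) => lorPow r p z.2 - lorPow r p z.1)
      ((2 * m : ℕ) : ℝ≥0∞) ((_root_.stdGaussian n).prod (_root_.stdGaussian n)) ≤
      ENNReal.ofReal (Real.pi * b) := by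
    rw [ENNReal.ofReal_mul Real.pi_pos.le]
    exact (eLpNorm_lorPow_prod_le hm hr hp hp2).trans (by gcongr)
  have h4 := measure_ge_le_of_eLpNorm_le (by omega)
    ((hc.comp measurable_snd).sub (hc.comp measurable_fst)) hτ h3
  rw [ENNReal.ofReal_mul (by norm_num), ENNReal.ofReal_ofNat]
  exact mul_le_mul_right h4 4

lemma exists_measure_le_of_median {n k m : ℕ} {r p M τ b : ℝ} (hk : 1 ≤ k) (hm : 1 ≤ m)
    (hkm : 5 * k ≤ 2 * m) (hr : 0 ≤ r) (hp : 1 ≤ p) (hp2 : p ≤ 2) (hM0 : 0 < M) (hτ : 0 < τ)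
    (hM : IsMedian (_root_.stdGaussian n) (lorNorm r p) M) (hb0 : 0 ≤ b)
    (hb : gradMoment n r p m ≤ ENNReal.ofReal b) :
    ∃ B : Set (Fin n → Fin k → ℝ),
      gaussMatrix n k B ≤ ENNReal.ofReal (6 * (6 * (Real.pi * b) / τ) ^ (2 * m)) ∧
      ∀ g ∉ B, ∀ x : EuclideanSpace ℝ (Fin k), ‖x‖ = 1 →
        |lorPow r p (mulVec g x) - M ^ p| ≤ 3 * τ := by
  have hp0 : 0 ≤ p := by linarith
  have hnorm : ∀ x : EuclideanSpace ℝ (Fin k), ‖x‖ = 1 → ∑ j, x j ^ 2 = 1 := fun x hx => by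
    have := EuclideanSpace.real_norm_sq_eq x
    rw [hx] at this
    linarith
  set x₀ : EuclideanSpace ℝ (Fin k) := EuclideanSpace.single ⟨0, hk⟩ 1 with hx₀
  have hx₀1 : ‖x₀‖ = 1 := by simp [hx₀]
  obtain ⟨B, hB, hBd⟩ := exists_measure_le_of_increments (μ := gaussMatrix n k) hk hkm
    (fun x g => lorPow r p (mulVec g x)) (fun x => measurable_lorPow_mulVec hr hp0 _)
    (fun g => (continuous_lorPow hr hp0).comp
      ((continuous_mulVec_right g).comp (PiLp.continuous_ofLp 2 _)))
    (A := Real.pi * b) (by positivity) hτ (by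
      intro x y hx hy
      refine (eLpNorm_lorPow_increment_le hm hr hp hp2 (hnorm x hx) (hnorm y hy)).trans ?_
      have hd : Real.sqrt (∑ j, (y j - x j) ^ 2) = dist x y := by
        rw [dist_comm, EuclideanSpace.dist_eq]
        simp [Real.dist_eq, sq_abs]
      rw [hd, show Real.pi * b * dist x y = Real.pi * dist x y * b by ring,
        ENNReal.ofReal_mul (p := Real.pi * dist x y) (by positivity)]
      exact mul_le_mul_right hb _) hx₀1
  have hdev := measure_lorPow_mulVec_sub_median_le hm hr hp hp2 hM0 hτ hM hb (hnorm x₀ hx₀1)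
  refine ⟨B ∪ {g | τ ≤ |lorPow r p (mulVec g x₀) - M ^ p|}, ?_, fun g hg x hx => ?_⟩
  · refine (measure_union_le _ _).trans ((add_le_add hB hdev).trans ?_)
    rw [← ENNReal.ofReal_add (by positivity) (by positivity)]
    refine ENNReal.ofReal_le_ofReal ?_
    have : (Real.pi * b / τ) ^ (2 * m) ≤ (6 * (Real.pi * b) / τ) ^ (2 * m) := by
      have : 0 ≤ Real.pi * b := by positivity
      exact pow_le_pow_left₀ (by positivity) (div_le_div_of_nonneg_right (by linarith) hτ.le) _
    linarith
  · simp only [Set.mem_union, Set.mem_ofPred_eq, not_or, not_le] at hg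
    have h1 := hBd g hg.1 x hx
    have h2 := abs_sub_le (lorPow r p (mulVec g x)) (lorPow r p (mulVec g x₀)) (M ^ p)
    linarith [hg.2]

/-- Main theorem, Case iv: there are universal constants `C, c > 0` such that for
`n ≥ 3`, `ε ∈ (0,1/2)`, `r ∈ (1/4,1/2]`, `p ∈ [1,3/2)` with `p = 2 - 2r`, set
`E = c n (1+(1-2r) ln n) ε² / ln n` and `F = c n ε^{2/p} / (ln n)^{(2-p)/p}`. If
`k ≤ min{E,F}` then with probability at least `1 - C exp(-min{E,F})`, for all `x ∈ ℝ^k`,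
`(1-ε) M_{r,p} |x| ≤ |Gx|_{r,p} ≤ (1+ε) M_{r,p} |x|`, where `M_{r,p}` is a median of
`|·|_{r,p}` under the standard Gaussian on `ℝ^n` (the law of `Ge₁`). -/
theorem dvoretzky_lorentz_case_iv :
    ∃ C c : ℝ, 0 < C ∧ 0 < c ∧
      ∀ (n k : ℕ) (ε r p : ℝ), 3 ≤ n → 0 < ε → ε < 1 / 2 →
        1 / 4 < r → r ≤ 1 / 2 → 1 ≤ p → p < 3 / 2 → p = 2 - 2 * r →
        (k : ℝ) ≤ min (c * n * (1 + (1 - 2 * r) * Real.log n) * ε ^ 2 / Real.log n)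
            (c * n * ε ^ (2 / p) / Real.log n ^ ((2 - p) / p)) →
        ∀ M : ℝ, IsMedian (stdGaussian n) (lorNorm r p) M →
          1 - C * Real.exp
              (-min (c * n * (1 + (1 - 2 * r) * Real.log n) * ε ^ 2 / Real.log n)
                (c * n * ε ^ (2 / p) / Real.log n ^ ((2 - p) / p))) ≤
            ((gaussMatrix n k) {g | ∀ x : Fin k → ℝ,
              (1 - ε) * M * eucNorm x ≤ lorNorm r p (mulVec g x) ∧
              lorNorm r p (mulVec g x) ≤ (1 + ε) * M * eucNorm x}).toReal := by
  obtain ⟨K, hK, hgrad⟩ := exists_gradMoment_le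
  set D : ℝ := 20000 ^ 2 with hD
  refine ⟨6, 1 / (32 * K * D + 1), by norm_num, by positivity, ?_⟩
  set c : ℝ := 1 / (32 * K * D + 1) with hc
  have hc0 : 0 < c := by positivity
  have hc1 : c ≤ 1 := by
    rw [hc, div_le_one (by positivity)]
    have : 0 < 32 * K * D := by positivity
    linarith
  have hcK : K * (32 * c) ≤ 1 / D := by
    rw [hc, show K * (32 * (1 / (32 * K * D + 1))) = 32 * K / (32 * K * D + 1) by ring,
      div_le_div_iff₀ (by positivity) (by positivity)]
    linarith
  intro n k ε r p hn hε hε2 hr hr2 hp hp2 hrp hk M hM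
  set Λ := min (c * n * (1 + (1 - 2 * r) * Real.log n) * ε ^ 2 / Real.log n)
            (c * n * ε ^ (2 / p) / Real.log n ^ ((2 - p) / p)) with hΛ
  have hp0 : 0 < p := by linarith
  have hn0 : (0 : ℝ) < n := by positivity
  obtain ⟨hM0, hMn⟩ := hM.lorNorm_lower (by omega) (by linarith) hp0 (by linarith) hrp
  set S := {g : Fin n → Fin k → ℝ | ∀ x : Fin k → ℝ,
              (1 - ε) * M * eucNorm x ≤ lorNorm r p (mulVec g x) ∧
              lorNorm r p (mulVec g x) ≤ (1 + ε) * M * eucNorm x} with hS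
  suffices h : ∃ B, gaussMatrix n k B ≤ ENNReal.ofReal (6 * Real.exp (-Λ)) ∧
      ∀ g ∉ B, ∀ x : EuclideanSpace ℝ (Fin k), ‖x‖ = 1 →
        |lorPow r p (mulVec g x) - M ^ p| ≤ ε * M ^ p by
    obtain ⟨B, hB, hBd⟩ := h
    have hcov : Set.univ ⊆ B ∪ S := fun g _ => by
      by_cases hg : g ∈ B
      · exact Or.inl hg
      · exact Or.inr (lorNorm_mulVec_bounds hp0 fun u hu =>
          lorNorm_bounds_of_lorPow hp hM0 hε (by linarith) (hBd g hg u hu))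
    have h1 : (1 : ℝ≥0∞) ≤ ENNReal.ofReal (6 * Real.exp (-Λ)) + gaussMatrix n k S := by
      rw [← measure_univ (μ := gaussMatrix n k)]
      exact (measure_mono hcov).trans ((measure_union_le _ _).trans (by gcongr))
    have h2 := ENNReal.toReal_mono (by finiteness) h1
    rw [ENNReal.toReal_add (by finiteness) (by finiteness), ENNReal.toReal_one,
      ENNReal.toReal_ofReal (by positivity)] at h2
    linarith
  rcases Nat.eq_zero_or_pos k with rfl | hk1
  · refine ⟨∅, by simp, fun g _ x hx => ?_⟩
    rw [Subsingleton.elim x 0, norm_zero] at hx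
    exact absurd hx (by norm_num)
  have hk1' : (1 : ℝ) ≤ k := by exact_mod_cast hk1
  have hΛ1 : 1 ≤ Λ := hk1'.trans hk
  set m := ⌈3 * Λ⌉₊ with hm
  have hm3 : 3 * Λ ≤ m := Nat.le_ceil _
  have hm4 : (m : ℝ) ≤ 4 * Λ := by
    have := Nat.ceil_lt_add_one (a := 3 * Λ) (by linarith)
    linarith
  have hm1 : 1 ≤ m := by
    have : (1 : ℝ) ≤ m := by linarith
    exact_mod_cast this
  have hkm : 5 * k ≤ 2 * m := by
    have : (5 * k : ℝ) ≤ 2 * m := by linarith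
    exact_mod_cast this
  have hprod : m * gradBound n (p - 1) m ≤ 32 * c * (n : ℝ) ^ p * ε ^ 2 := by
    refine mul_gradBound_le hn hc0 hc1 hε hp (by linarith) (by linarith) hm4 ?_ (min_le_right _ _)
    rw [show p - 1 = 1 - 2 * r by rw [hrp]; ring]
    exact min_le_left _ _
  set b := Real.sqrt (K * m * gradBound n (p - 1) m) with hb
  have hbn : b ≤ ε * (n : ℝ) ^ (p / 2) / 20000 := by
    refine Real.sqrt_le_iff.2 ⟨by positivity, ?_⟩
    calc K * m * gradBound n (p - 1) m ≤ K * (32 * c * (n : ℝ) ^ p * ε ^ 2) := by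
          rw [mul_assoc]; gcongr
      _ = K * (32 * c) * ((n : ℝ) ^ p * ε ^ 2) := by ring
      _ ≤ 1 / D * ((n : ℝ) ^ p * ε ^ 2) := by gcongr
      _ = _ := by
          have : (n : ℝ) ^ p = ((n : ℝ) ^ (p / 2)) ^ 2 := by
            rw [← Real.rpow_mul_natCast hn0.le]; congr 1; push_cast; ring
          rw [this, hD]; ring
  obtain ⟨B, hB, hBd⟩ := exists_measure_le_of_median (k := k) (τ := ε * M ^ p / 3) hk1 hm1 hkm
    (by linarith) hp (by linarith) hM0 (by positivity) hM (Real.sqrt_nonneg _)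
    (hgrad n m r p hn hm1 hp (by linarith) hrp)
  refine ⟨B, hB.trans (ENNReal.ofReal_le_ofReal ?_), fun g hg x hx => ?_⟩
  · have hratio : 6 * (Real.pi * b) / (ε * M ^ p / 3) ≤ Real.exp (-1) := by
      rw [Real.exp_neg, ← one_div, div_le_div_iff₀ (by positivity) (Real.exp_pos _)]
      have h1 : Real.pi * Real.exp 1 ≤ 3.15 * 2.7182818286 :=
        mul_le_mul Real.pi_lt_d2.le Real.exp_one_lt_d9.le (Real.exp_pos _).le (by norm_num)
      have hb0 : 0 ≤ b := Real.sqrt_nonneg _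
      have h2 : ε * ((n : ℝ) ^ (p / 2) / 128) ≤ ε * M ^ p := by gcongr
      have h3 : 6 * (Real.pi * b) * Real.exp 1 ≤ 6 * (3.15 * 2.7182818286) * b := by nlinarith
      linarith
    calc 6 * (6 * (Real.pi * b) / (ε * M ^ p / 3)) ^ (2 * m) ≤ 6 * Real.exp (-1) ^ (2 * m) := by
          gcongr
      _ = 6 * Real.exp (-(2 * m)) := by
          rw [← Real.exp_nat_mul]; push_cast; ring_nf
      _ ≤ _ := by gcongr; linarith
  · have := hBd g hg x hx
    linarith
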